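/- arXiv:2308.11238 — 2 statements merged into one kernel-verified Lean document; each statement's English description precedes it below -/
import Mathlib

section
/- Optimality within ordinal-sum copulas for ISS distortions: Let h be an inverse S-shaped distortion function with inflection point p∈(0,1). If X, Y are bounded random variables with copula C^±_p, then E^h[X+Y] ≤ E^h[X'+Y'] for all bounded X', Y' with X' equal in distribution to X, Y' equal in distribution to Y, and such that (X',Y') has some copula C' with C'(1−p,1−p) = 1−p. Moreover, if h is strictly inverse S-shaped, then C^±_p is the unique copula in 𝒞_p = {C : C(1−p,1−p)=1−p} that is universally optimal within 𝒞_p for h. -/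
open MeasureTheory Set ProbabilityTheory

noncomputable section

variable {Ω : Type*} [MeasurableSpace Ω]

/-- An atomless probability measure: every non-null measurable set has a measurable
subset of strictly smaller positive measure. -/
def AtomlessProb (P : Measure Ω) : Prop :=
  ∀ A : Set Ω, MeasurableSet A → 0 < P A →
    ∃ B ⊆ A, MeasurableSet B ∧ 0 < P B ∧ P B < P A

/-- A distortion function: increasing on `[0,1]` with `h 0 = 0` and `h 1 = 1`. -/
def IsDistortion (h : ℝ → ℝ) : Prop :=
  MonotoneOn h (Icc 0 1) ∧ h 0 = 0 ∧ h 1 = 1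

/-- The distorted expectation `E^h[Z]`. -/
def distExp (P : Measure Ω) (h : ℝ → ℝ) (Z : Ω → ℝ) : ℝ :=
  (∫ x in Ioi (0:ℝ), h (P {ω | Z ω > x}).toReal) +
  (∫ x in Iio (0:ℝ), (h (P {ω | Z ω > x}).toReal - 1))

/-- Bounded measurable real random variable. -/
def IsBddRV (X : Ω → ℝ) : Prop :=
  Measurable X ∧ ∃ M : ℝ, ∀ ω, |X ω| ≤ M

/-- X and Y are comonotonic. -/
def Comonotone (P : Measure Ω) (X Y : Ω → ℝ) : Prop :=
  ∃ f g : ℝ → ℝ, Monotone f ∧ Monotone g ∧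
    ∀ᵐ ω ∂P, X ω = f (X ω + Y ω) ∧ Y ω = g (X ω + Y ω)

/-- X and Y are counter-monotonic: X and -Y are comonotonic. -/
def CounterMonotone (P : Measure Ω) (X Y : Ω → ℝ) : Prop :=
  Comonotone P X (fun ω => -Y ω)

def Submodular (c : ℝ → ℝ → ℝ) : Prop :=
  ∀ x₁ y₁ x₂ y₂ : ℝ,
    c (min x₁ x₂) (min y₁ y₂) + c (max x₁ x₂) (max y₁ y₂) ≤ c x₁ y₁ + c x₂ y₂

def Supermodular (c : ℝ → ℝ → ℝ) : Prop :=
  ∀ x₁ y₁ x₂ y₂ : ℝ,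
    c x₁ y₁ + c x₂ y₂ ≤ c (min x₁ x₂) (min y₁ y₂) + c (max x₁ x₂) (max y₁ y₂)

/-- c is monotone: increasing in each argument or decreasing in each argument. -/
def MonotoneCost (c : ℝ → ℝ → ℝ) : Prop :=
  Monotone (fun q : ℝ × ℝ => c q.1 q.2) ∨ Antitone (fun q : ℝ × ℝ => c q.1 q.2)

/-- A 2-copula. -/
def IsCopula (C : ℝ → ℝ → ℝ) : Prop :=
  (∀ u ∈ Icc (0:ℝ) 1, C u 0 = 0 ∧ C 0 u = 0 ∧ C u 1 = u ∧ C 1 u = u) ∧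
  (∀ u₁ u₂ v₁ v₂ : ℝ, u₁ ∈ Icc (0:ℝ) 1 → u₂ ∈ Icc (0:ℝ) 1 →
    v₁ ∈ Icc (0:ℝ) 1 → v₂ ∈ Icc (0:ℝ) 1 → u₁ ≤ u₂ → v₁ ≤ v₂ →
    0 ≤ C u₂ v₂ - C u₂ v₁ - C u₁ v₂ + C u₁ v₁)

/-- (X, Y) has copula C. -/
def HasCopula (P : Measure Ω) (X Y : Ω → ℝ) (C : ℝ → ℝ → ℝ) : Prop :=
  ∀ x y : ℝ, (P {ω | X ω ≤ x ∧ Y ω ≤ y}).toReal =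
    C (P {ω | X ω ≤ x}).toReal (P {ω | Y ω ≤ y}).toReal

/-- C is universally optimal for h with linear cost. -/
def UnivOptimal (P : Measure Ω) (h : ℝ → ℝ) (C : ℝ → ℝ → ℝ) : Prop :=
  ∀ X Y X' Y' : Ω → ℝ, IsBddRV X → IsBddRV Y → IsBddRV X' → IsBddRV Y' →
    HasCopula P X Y C → IdentDistrib X X' P P → IdentDistrib Y Y' P P →
    distExp P h (fun ω => X ω + Y ω) ≤ distExp P h (fun ω => X' ω + Y' ω)

/-- C is universally maximal for h with linear cost. -/
def UnivMaximal (P : Measure Ω) (h : ℝ → ℝ) (C : ℝ → ℝ → ℝ) : Prop :=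
  ∀ X Y X' Y' : Ω → ℝ, IsBddRV X → IsBddRV Y → IsBddRV X' → IsBddRV Y' →
    HasCopula P X Y C → IdentDistrib X X' P P → IdentDistrib Y Y' P P →
    distExp P h (fun ω => X' ω + Y' ω) ≤ distExp P h (fun ω => X ω + Y ω)

/-- C is universally optimal within a class 𝒞 of copulas for h with linear cost. -/
def UnivOptimalWithin (P : Measure Ω) (h : ℝ → ℝ) (C : ℝ → ℝ → ℝ)
    (𝒞 : Set (ℝ → ℝ → ℝ)) : Prop :=
  ∀ X Y X' Y' : Ω → ℝ, IsBddRV X → IsBddRV Y → IsBddRV X' → IsBddRV Y' →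
    HasCopula P X Y C → (∃ C' ∈ 𝒞, HasCopula P X' Y' C') →
    IdentDistrib X X' P P → IdentDistrib Y Y' P P →
    distExp P h (fun ω => X ω + Y ω) ≤ distExp P h (fun ω => X' ω + Y' ω)

/-- C is universally maximal within a class 𝒞 of copulas for h with linear cost. -/
def UnivMaximalWithin (P : Measure Ω) (h : ℝ → ℝ) (C : ℝ → ℝ → ℝ)
    (𝒞 : Set (ℝ → ℝ → ℝ)) : Prop :=
  ∀ X Y X' Y' : Ω → ℝ, IsBddRV X → IsBddRV Y → IsBddRV X' → IsBddRV Y' →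
    HasCopula P X Y C → (∃ C' ∈ 𝒞, HasCopula P X' Y' C') →
    IdentDistrib X X' P P → IdentDistrib Y Y' P P →
    distExp P h (fun ω => X' ω + Y' ω) ≤ distExp P h (fun ω => X ω + Y ω)

/-- The set 𝒞_p of copulas C with C(1-p,1-p) = 1-p. -/
def copulaSet (p : ℝ) : Set (ℝ → ℝ → ℝ) :=
  {C | IsCopula C ∧ C (1 - p) (1 - p) = 1 - p}

/-- The "first comonotonic, then counter-monotonic" copula C^±_p. -/
def Cpm (p : ℝ) (u v : ℝ) : ℝ :=
  if min u v ≤ 1 - p then min u v else max (u + v - 1) (1 - p)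

/-- The "first counter-monotonic, then comonotonic" copula C^∓_p. -/
def Cmp (p : ℝ) (u v : ℝ) : ℝ :=
  if max u v ≤ 1 - p then max (u + v - 1 + p) 0 else min u v

/-- Inverse S-shaped distortion with inflection point p: continuous, concave on (0,p),
convex on (p,1). -/
def IsISS (h : ℝ → ℝ) (p : ℝ) : Prop :=
  ContinuousOn h (Icc 0 1) ∧ ConcaveOn ℝ (Ioo 0 p) h ∧ ConvexOn ℝ (Ioo p 1) h

/-- Strictly inverse S-shaped distortion with inflection point p. -/
def IsStrictISS (h : ℝ → ℝ) (p : ℝ) : Prop :=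
  ContinuousOn h (Icc 0 1) ∧ StrictConcaveOn ℝ (Ioo 0 p) h ∧ StrictConvexOn ℝ (Ioo p 1) h

/-- S-shaped distortion with inflection point p: continuous, convex on (0,p),
concave on (p,1). -/
def IsSS (h : ℝ → ℝ) (p : ℝ) : Prop :=
  ContinuousOn h (Icc 0 1) ∧ ConvexOn ℝ (Ioo 0 p) h ∧ ConcaveOn ℝ (Ioo p 1) h

/-- Strictly S-shaped distortion with inflection point p. -/
def IsStrictSS (h : ℝ → ℝ) (p : ℝ) : Prop :=
  ContinuousOn h (Icc 0 1) ∧ StrictConvexOn ℝ (Ioo 0 p) h ∧ StrictConcaveOn ℝ (Ioo p 1) h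

/-- Left quantile of Z at level t. -/
def leftQuantile (P : Measure Ω) (Z : Ω → ℝ) (t : ℝ) : ℝ :=
  sInf {x : ℝ | t ≤ (P {ω | Z ω ≤ x}).toReal}

/-- W is (a version of) the upper p-tail transform Z^∨_p of Z: its left-quantile
function is t ↦ Q_{(1-p)+pt}(Z). -/
def IsUpperTail (P : Measure Ω) (p : ℝ) (Z W : Ω → ℝ) : Prop :=
  ∀ t ∈ Ioc (0:ℝ) 1, leftQuantile P W t = leftQuantile P Z ((1 - p) + p * t)

/-- W is (a version of) the lower tail transform Z^∧_p of Z: its left-quantile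
function is t ↦ Q_{(1-p)t}(Z). -/
def IsLowerTail (P : Measure Ω) (p : ℝ) (Z W : Ω → ℝ) : Prop :=
  ∀ t ∈ Ioc (0:ℝ) 1, leftQuantile P W t = leftQuantile P Z ((1 - p) * t)

/-- Expected Shortfall at level p. -/
def ES (P : Measure Ω) (p : ℝ) (Z : Ω → ℝ) : ℝ :=
  (1 / (1 - p)) * ∫ r in p..1, leftQuantile P Z r

/-! ### Concave functions on intervals -/

lemma ConcaveOn.Icc_of_Ioo {h : ℝ → ℝ} {a b : ℝ} (hab : a < b)
    (hc : ContinuousOn h (Icc a b)) (hh : ConcaveOn ℝ (Ioo a b) h) :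
    ConcaveOn ℝ (Icc a b) h := by
  refine ⟨convex_Icc a b, ?_⟩
  intro x hx y hy α β hα hβ hαβ
  have key : ∀ z ∈ Icc a b, Filter.Tendsto (fun t : ℝ => h ((1 - t) * z + t * ((a + b) / 2)))
      (nhdsWithin 0 (Ioo 0 1)) (nhds (h z)) := by
    intro z hz
    have h1 : ContinuousWithinAt h (Icc a b) ((1 - (0:ℝ)) * z + 0 * ((a + b) / 2)) := by
      simpa using hc z hz
    have h2 : ContinuousWithinAt (fun t : ℝ => (1 - t) * z + t * ((a + b) / 2)) (Ioo 0 1) 0 := by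
      fun_prop
    have h3 := ContinuousWithinAt.comp (f := fun t : ℝ => (1 - t) * z + t * ((a + b) / 2)) (x := 0)
      h1 h2 (fun t ht => by
      have := hz.1; have := hz.2; have := ht.1; have := ht.2
      constructor <;> nlinarith)
    simpa [ContinuousWithinAt, Function.comp_def] using h3
  have hz : α • x + β • y ∈ Icc a b := (convex_Icc a b) hx hy hα hβ hαβ
  have : (nhdsWithin (0:ℝ) (Ioo 0 1)).NeBot := by
    rw [← mem_closure_iff_nhdsWithin_neBot, closure_Ioo (by norm_num)]
    simp
  refine le_of_tendsto_of_tendsto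
    (((key x hx).const_smul α).add ((key y hy).const_smul β)) (key _ hz) ?_
  filter_upwards [self_mem_nhdsWithin] with t ht
  have mem : ∀ z ∈ Icc a b, (1 - t) * z + t * ((a + b) / 2) ∈ Ioo a b := by
    intro z hz
    have := hz.1; have := hz.2; have := ht.1; have := ht.2
    constructor <;> nlinarith
  have := hh.2 (mem x hx) (mem y hy) hα hβ hαβ
  convert this using 2
  simp only [smul_eq_mul]
  linear_combination (- t * ((a + b) / 2)) * hαβ

lemma ConcaveOn.add_le_add_of_spread {h : ℝ → ℝ} {s : Set ℝ} (hh : ConcaveOn ℝ s h)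
    {A B D : ℝ} (hA : A ∈ s) (hD : D ∈ s) (hAB : A ≤ B) (hBD : B ≤ D) :
    h A + h D ≤ h B + h (A + D - B) := by
  rcases eq_or_lt_of_le (hAB.trans hBD) with hAD | hAD
  · have : B = A := by linarith
    subst this
    simp
  · have hpos : 0 < D - A := sub_pos.2 hAD
    have e1 := hh.2 hA hD
      (show 0 ≤ (D - B) / (D - A) from div_nonneg (by linarith) hpos.le)
      (show 0 ≤ (B - A) / (D - A) from div_nonneg (by linarith) hpos.le)
      (by field_simp; ring)
    have e2 := hh.2 hA hD
      (show 0 ≤ (B - A) / (D - A) from div_nonneg (by linarith) hpos.le)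
      (show 0 ≤ (D - B) / (D - A) from div_nonneg (by linarith) hpos.le)
      (by field_simp; ring)
    have i1 : ((D - B) / (D - A)) • A + ((B - A) / (D - A)) • D = B := by
      simp only [smul_eq_mul]; field_simp; ring
    have i2 : ((B - A) / (D - A)) • A + ((D - B) / (D - A)) • D = A + D - B := by
      simp only [smul_eq_mul]; field_simp; ring
    rw [i1] at e1
    rw [i2] at e2
    have i3 : (D - B) / (D - A) + (B - A) / (D - A) = 1 := by field_simp; ring
    simp only [smul_eq_mul] at e1 e2
    linear_combination e1 + e2 - (h A + h D) * i3

lemma StrictConcaveOn.add_lt_add_of_spread {h : ℝ → ℝ} {s : Set ℝ} (hh : StrictConcaveOn ℝ s h)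
    {A B D : ℝ} (hA : A ∈ s) (hD : D ∈ s) (hAB : A < B) (hBD : B < D) :
    h A + h D < h B + h (A + D - B) := by
  have hAD := hAB.trans hBD
  have hpos : 0 < D - A := sub_pos.2 hAD
  have e1 := hh.2 hA hD hAD.ne
    (show 0 < (D - B) / (D - A) from div_pos (by linarith) hpos)
    (show 0 < (B - A) / (D - A) from div_pos (by linarith) hpos)
    (by field_simp; ring)
  have e2 := hh.2 hA hD hAD.ne
    (show 0 < (B - A) / (D - A) from div_pos (by linarith) hpos)
    (show 0 < (D - B) / (D - A) from div_pos (by linarith) hpos)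
    (by field_simp; ring)
  have i1 : ((D - B) / (D - A)) • A + ((B - A) / (D - A)) • D = B := by
    simp only [smul_eq_mul]; field_simp; ring
  have i2 : ((B - A) / (D - A)) • A + ((D - B) / (D - A)) • D = A + D - B := by
    simp only [smul_eq_mul]; field_simp; ring
  rw [i1] at e1
  rw [i2] at e2
  have i3 : (D - B) / (D - A) + (B - A) / (D - A) = 1 := by field_simp; ring
  simp only [smul_eq_mul] at e1 e2
  linear_combination e1 + e2 - (h A + h D) * i3

lemma StrictConcaveOn.add_lt_add_of_spread_Icc {h : ℝ → ℝ} {a b : ℝ} (hab : a < b)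
    (hc : ContinuousOn h (Icc a b)) (hh : StrictConcaveOn ℝ (Ioo a b) h)
    {A B D : ℝ} (hA : a ≤ A) (hD : D ≤ b) (hAB : A < B) (hBD : B < D) :
    h A + h D < h B + h (A + D - B) := by
  obtain ⟨A', h1, h2⟩ := exists_between (show A < min B (A + D - B) from
    lt_min hAB (by linarith))
  have h3 := lt_of_lt_of_le h2 (min_le_left _ _)
  have h4 := lt_of_lt_of_le h2 (min_le_right _ _)
  have k1 := (hh.concaveOn.Icc_of_Ioo hab hc).add_le_add_of_spread (A := A) (B := A') (D := D)
    ⟨hA, by linarith⟩ ⟨by linarith, hD⟩ h1.le (by linarith)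
  have k2 := hh.add_lt_add_of_spread (A := A') (B := B) (D := A + D - A')
    ⟨by linarith, by linarith⟩ ⟨by linarith, by linarith⟩ h3 (by linarith)
  have : A' + (A + D - A') - B = A + D - B := by ring
  rw [this] at k2
  linarith

/-- A nonnegative antitone choice of supergradients of an increasing concave function. -/
lemma ConcaveOn.exists_antitone_supergradient {h : ℝ → ℝ} {p : ℝ}
    (hh : ConcaveOn ℝ (Icc 0 p) h) (hm : MonotoneOn h (Icc 0 p)) :
    ∃ k : ℝ → ℝ, AntitoneOn k (Ioc 0 p) ∧ (∀ y ∈ Ioc 0 p, 0 ≤ k y) ∧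
      ∀ y ∈ Ioc 0 p, ∀ x ∈ Icc 0 p, h x ≤ h y + k y * (x - y) := by
  let k : ℝ → ℝ := fun y => sInf ((fun z => (h y - h z) / (y - z)) '' Ico 0 y)
  have nonneg : ∀ y ∈ Ioc 0 p, ∀ z ∈ Ico 0 y, 0 ≤ (h y - h z) / (y - z) := by
    intro y hy z hz
    refine div_nonneg (sub_nonneg.2 (hm ⟨hz.1, hz.2.le.trans hy.2⟩ ⟨hy.1.le, hy.2⟩ hz.2.le)) ?_
    linarith [hz.2]
  have le_slope : ∀ y ∈ Ioc 0 p, ∀ z ∈ Ico 0 y, k y ≤ (h y - h z) / (y - z) := by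
    intro y hy z hz
    refine csInf_le ⟨0, ?_⟩ (mem_image_of_mem _ hz)
    rintro _ ⟨z, hz, rfl⟩
    exact nonneg y hy z hz
  have ne : ∀ y ∈ Ioc 0 p, ((fun z => (h y - h z) / (y - z)) '' Ico 0 y).Nonempty :=
    fun y hy => ⟨_, mem_image_of_mem _ ⟨le_rfl, hy.1⟩⟩
  have slope_le : ∀ y ∈ Ioc 0 p, ∀ x ∈ Icc 0 p, y < x → (h x - h y) / (x - y) ≤ k y := by
    intro y hy x hx hxy
    refine le_csInf (ne y hy) ?_
    rintro _ ⟨z, hz, rfl⟩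
    exact hh.slope_anti_adjacent ⟨hz.1, hz.2.le.trans hy.2⟩ hx hz.2 hxy
  refine ⟨k, ?_, ?_, ?_⟩
  · intro y hy y' hy' hyy
    rcases eq_or_lt_of_le hyy with rfl | hlt
    · exact le_rfl
    · exact (le_slope y' hy' y ⟨hy.1.le, hlt⟩).trans (slope_le y hy y' ⟨hy'.1.le, hy'.2⟩ hlt)
  · intro y hy
    refine le_csInf (ne y hy) ?_
    rintro _ ⟨z, hz, rfl⟩
    exact nonneg y hy z hz
  · intro y hy x hx
    rcases lt_trichotomy x y with hxy | rfl | hxy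
    · have := le_slope y hy x ⟨hx.1, hxy⟩
      rw [le_div_iff₀ (by linarith)] at this
      linarith
    · simp
    · have := slope_le y hy x hx hxy
      rw [div_le_iff₀ (by linarith)] at this
      linarith

/-! ### Integral comparison -/

/-- If all tail integrals of `φ` are nonpositive then so is its integral against a nonnegative
bounded increasing weight. -/
lemma integral_monotone_mul_nonpos {w φ : ℝ → ℝ} {a b K : ℝ} (hab : a ≤ b) (hw : Monotone w)
    (hw0 : ∀ x, 0 ≤ w x) (hwK : ∀ x, w x ≤ K) (hφ : IntervalIntegrable φ volume a b)
    (htail : ∀ t ∈ Icc a b, ∫ x in t..b, φ x ≤ 0) :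
    ∫ x in a..b, w x * φ x ≤ 0 := by
  have hφ' : Integrable φ (volume.restrict (Ioc a b)) :=
    (intervalIntegrable_iff_integrableOn_Ioc_of_le hab).1 hφ
  let S : Set (ℝ × ℝ) := {z | z.2 < w z.1}
  have hS : MeasurableSet S :=
    measurableSet_lt measurable_snd (hw.measurable.comp measurable_fst)
  have hint : Integrable (Function.uncurry fun x l : ℝ => S.indicator (fun z => φ z.1) (x, l))
      ((volume.restrict (Ioc a b)).prod (volume.restrict (Ioc 0 K))) := by
    have := (hφ'.comp_fst (volume.restrict (Ioc 0 K))).indicator hS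
    exact this
  have hswap := integral_integral_swap hint
  have hL : ∀ x, ∫ l in Ioc 0 K, S.indicator (fun z => φ z.1) (x, l) = w x * φ x := by
    intro x
    have : (fun l => S.indicator (fun z => φ z.1) (x, l)) =
        (Iio (w x)).indicator (fun _ => φ x) := by
      ext l
      simp [S, indicator]
    rw [this, integral_indicator measurableSet_Iio, Measure.restrict_restrict measurableSet_Iio,
      setIntegral_const]
    have hae : (Iio (w x) ∩ Ioc 0 K : Set ℝ) =ᵐ[volume] Ioc 0 (w x) := by
      have : (Iio (w x) ∩ Ioc 0 K : Set ℝ) = Ioo 0 (w x) := by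
        ext l
        simp only [mem_inter_iff, mem_Iio, mem_Ioc, mem_Ioo]
        have := hwK x
        constructor
        · rintro ⟨h1, h2, h3⟩; exact ⟨h2, h1⟩
        · rintro ⟨h1, h2⟩; exact ⟨h2, h1, by linarith⟩
      rw [this]
      exact Ioo_ae_eq_Ioc
    rw [measureReal_congr hae]
    simp [hw0 x]
  simp_rw [hL] at hswap
  rw [intervalIntegral.integral_of_le hab, hswap]
  refine integral_nonpos fun l => ?_
  have : (fun x => S.indicator (fun z => φ z.1) (x, l)) =
        {x | l < w x}.indicator φ := by
    ext x
    simp [S, indicator]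
  have hmeas : MeasurableSet {x | l < w x} := measurableSet_lt measurable_const hw.measurable
  show ∫ x in Ioc a b, S.indicator (fun z => φ z.1) (x, l) ≤ 0
  rw [this, integral_indicator hmeas, Measure.restrict_restrict hmeas]
  by_cases hne : ({x | l < w x} ∩ Icc a b).Nonempty
  · set t := sInf ({x | l < w x} ∩ Icc a b) with ht
    have hbdd : BddBelow ({x | l < w x} ∩ Icc a b) := ⟨a, fun x hx => hx.2.1⟩
    have hta : a ≤ t := le_csInf hne fun x hx => hx.2.1
    have htb : t ≤ b := by
      obtain ⟨x, hx⟩ := hne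
      exact (csInf_le hbdd hx).trans hx.2.2
    have hae : ({x | l < w x} ∩ Ioc a b : Set ℝ) =ᵐ[volume] Ioc t b := by
      have h1 : ∀ᵐ x : ℝ, x ≠ t := by simp [ae_iff]
      filter_upwards [h1] with x hx
      refine propext ⟨fun h => ?_, fun h => ?_⟩
      · have h : l < w x ∧ a < x ∧ x ≤ b := h
        exact ⟨lt_of_le_of_ne (csInf_le hbdd ⟨h.1, h.2.1.le, h.2.2⟩) (Ne.symm hx), h.2.2⟩
      · obtain ⟨y, hy, hyx⟩ := exists_lt_of_csInf_lt hne h.1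
        exact ⟨lt_of_lt_of_le hy.1 (hw hyx.le), lt_of_le_of_lt hta h.1, h.2⟩
    rw [setIntegral_congr_set hae, ← intervalIntegral.integral_of_le htb]
    exact htail t ⟨hta, htb⟩
  · have : ({x | l < w x} ∩ Ioc a b : Set ℝ) = ∅ := by
      by_contra h
      obtain ⟨x, hx⟩ := nonempty_iff_ne_empty.2 h
      exact hne ⟨x, hx.1, hx.2.1.le, hx.2.2⟩
    simp [this]

lemma integral_comp_le_of_tail_le_of_pos {H f₁ f₂ : ℝ → ℝ} {a b p δ : ℝ} (hab : a ≤ b)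
    (hδ : 0 < δ) (hδp : δ ≤ p)
    (hH : Monotone H) (hconc : ConcaveOn ℝ (Icc 0 p) H) (h₁ : Antitone f₁) (h₂ : Antitone f₂)
    (hf₁ : ∀ x ∈ Ioo a b, f₁ x ∈ Icc δ p) (hf₂ : ∀ x ∈ Ioo a b, f₂ x ∈ Icc δ p)
    (htail : ∀ t ∈ Icc a b, ∫ x in t..b, f₁ x ≤ ∫ x in t..b, f₂ x) :
    ∫ x in a..b, H (f₁ x) ≤ ∫ x in a..b, H (f₂ x) := by
  obtain ⟨k, hk, hk0, hkH⟩ := hconc.exists_antitone_supergradient (hH.monotoneOn _)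
  let w : ℝ → ℝ := fun x => k (max δ (min p (f₂ x)))
  have hmem : ∀ y, max δ (min p y) ∈ Ioc 0 p := fun y =>
    ⟨lt_of_lt_of_le hδ (le_max_left _ _), max_le hδp (min_le_left _ _)⟩
  have hw : Monotone w := fun x y hxy =>
    hk (hmem _) (hmem _) (max_le_max le_rfl (min_le_min le_rfl (h₂ hxy)))
  have i₁ : ∀ s t, IntervalIntegrable f₁ volume s t := fun s t => h₁.intervalIntegrable
  have i₂ : ∀ s t, IntervalIntegrable f₂ volume s t := fun s t => h₂.intervalIntegrable
  have j₁ : IntervalIntegrable (fun x => H (f₁ x)) volume a b :=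
    (hH.comp_antitone h₁).intervalIntegrable
  have j₂ : IntervalIntegrable (fun x => H (f₂ x)) volume a b :=
    (hH.comp_antitone h₂).intervalIntegrable
  have hwint : IntervalIntegrable (fun x => w x * (f₁ x - f₂ x)) volume a b := by
    have hd := (i₁ a b).sub (i₂ a b)
    rw [intervalIntegrable_iff] at hd ⊢
    refine hd.bdd_mul (c := k δ) hw.measurable.aestronglyMeasurable (.of_forall fun x => ?_)
    rw [Real.norm_of_nonneg (hk0 _ (hmem _))]
    exact hk ⟨hδ, hδp⟩ (hmem _) (le_max_left _ _)
  have hW := integral_monotone_mul_nonpos (w := w) (φ := fun x => f₁ x - f₂ x) (K := k δ) hab hw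
    (fun x => hk0 _ (hmem _)) (fun x => hk ⟨hδ, hδp⟩ (hmem _) (le_max_left _ _))
    ((i₁ a b).sub (i₂ a b)) (fun t ht => by
      rw [intervalIntegral.integral_sub (i₁ _ _) (i₂ _ _)]
      linarith [htail t ht])
  have hmono : ∫ x in a..b, H (f₁ x) ≤ ∫ x in a..b, (H (f₂ x) + w x * (f₁ x - f₂ x)) := by
    refine intervalIntegral.integral_mono_on_of_le_Ioo hab j₁ (j₂.add hwint) fun x hx => ?_
    have e2 := hf₂ x hx
    have e1 := hf₁ x hx
    have : w x = k (f₂ x) := by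
      simp only [w]
      rw [min_eq_right e2.2, max_eq_right e2.1]
    rw [this]
    exact hkH _ ⟨hδ.trans_le e2.1, e2.2⟩ _ ⟨hδ.le.trans e1.1, e1.2⟩
  rw [intervalIntegral.integral_add j₂ hwint] at hmono
  linarith

/-- Weak majorization inequality for increasing concave functions. -/
lemma integral_comp_le_of_tail_le {H f₁ f₂ : ℝ → ℝ} {a b p : ℝ} (hab : a ≤ b) (hp : 0 < p)
    (hH : Monotone H) (hcont : Continuous H) (hconc : ConcaveOn ℝ (Icc 0 p) H)
    (h₁ : Antitone f₁) (h₂ : Antitone f₂)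
    (hf₁ : ∀ x ∈ Ioo a b, f₁ x ∈ Icc 0 p) (hf₂ : ∀ x ∈ Ioo a b, f₂ x ∈ Icc 0 p)
    (htail : ∀ t ∈ Icc a b, ∫ x in t..b, f₁ x ≤ ∫ x in t..b, f₂ x) :
    ∫ x in a..b, H (f₁ x) ≤ ∫ x in a..b, H (f₂ x) := by
  have lim : ∀ f : ℝ → ℝ, Antitone f → (∀ x ∈ Ioo a b, f x ∈ Icc 0 p) →
      Filter.Tendsto (fun e : ℝ => ∫ x in a..b, H (e * p + (1 - e) * f x))
        (nhdsWithin 0 (Ioo 0 1)) (nhds (∫ x in a..b, H (f x))) := by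
    intro f hf hfp
    have hae : ∀ᵐ x : ℝ, x ≠ b := by simp [ae_iff]
    refine intervalIntegral.tendsto_integral_filter_of_dominated_convergence
      (fun _ => max |H 0| |H p|) ?_ ?_ intervalIntegrable_const ?_
    · refine .of_forall fun e => ?_
      exact (hH.measurable.comp (measurable_const.add
        (hf.measurable.const_mul (1 - e)))).aestronglyMeasurable
    · filter_upwards [self_mem_nhdsWithin] with e he
      filter_upwards [hae] with x hx hxab
      rw [uIoc_of_le hab] at hxab
      have hv := hfp x ⟨hxab.1, lt_of_le_of_ne hxab.2 hx⟩
      have := he.1; have := he.2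
      have h1 : 0 ≤ e * p + (1 - e) * f x := by nlinarith [hv.1]
      have h2 : e * p + (1 - e) * f x ≤ p := by nlinarith [hv.2]
      rw [Real.norm_eq_abs]
      exact abs_le_max_abs_abs (hH h1) (hH h2)
    · refine .of_forall fun x _ => ?_
      have : Continuous fun e : ℝ => H (e * p + (1 - e) * f x) := by fun_prop
      have := this.tendsto 0
      simp only [zero_mul, sub_zero, one_mul, zero_add] at this
      exact this.mono_left nhdsWithin_le_nhds
  have : (nhdsWithin (0:ℝ) (Ioo 0 1)).NeBot := by
    rw [← mem_closure_iff_nhdsWithin_neBot, closure_Ioo (by norm_num)]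
    simp
  refine le_of_tendsto_of_tendsto (lim f₁ h₁ hf₁) (lim f₂ h₂ hf₂) ?_
  filter_upwards [self_mem_nhdsWithin] with e he
  have he0 := he.1
  have he1 := he.2
  have anti : ∀ f : ℝ → ℝ, Antitone f → Antitone fun x => e * p + (1 - e) * f x := by
    intro f hf x y hxy
    have := hf hxy
    simp only
    nlinarith
  have rng : ∀ f : ℝ → ℝ, (∀ x ∈ Ioo a b, f x ∈ Icc 0 p) →
      ∀ x ∈ Ioo a b, e * p + (1 - e) * f x ∈ Icc (e * p) p := by
    intro f hf x hx
    have := hf x hx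
    constructor <;> nlinarith [this.1, this.2]
  refine integral_comp_le_of_tail_le_of_pos hab (δ := e * p) (p := p) (by positivity)
    (by nlinarith) hH hconc (anti _ h₁) (anti _ h₂) (rng _ hf₁) (rng _ hf₂) fun t ht => ?_
  rw [intervalIntegral.integral_add, intervalIntegral.integral_add,
    intervalIntegral.integral_const_mul (1 - e), intervalIntegral.integral_const_mul (1 - e)]
  · have := mul_le_mul_of_nonneg_left (htail t ht) (sub_nonneg.2 he1.le)
    linarith
  · simp
  · exact h₂.intervalIntegrable.const_mul _
  · simp
  · exact h₁.intervalIntegrable.const_mul _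

/-! ### Distribution functions and distorted expectations -/

lemma toReal_prob_mem_Icc (P : Measure Ω) [IsProbabilityMeasure P] (A : Set Ω) :
    (P A).toReal ∈ Icc (0 : ℝ) 1 :=
  ⟨ENNReal.toReal_nonneg, ENNReal.toReal_le_of_le_ofReal zero_le_one (by simpa using prob_le_one)⟩

lemma toReal_prob_gt (P : Measure Ω) [IsProbabilityMeasure P] {Z : Ω → ℝ} (hZ : Measurable Z)
    (x : ℝ) : (P {ω | Z ω > x}).toReal = 1 - (P {ω | Z ω ≤ x}).toReal := by
  have : {ω | Z ω > x} = {ω | Z ω ≤ x}ᶜ := by ext; simp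
  rw [this]
  exact probReal_compl_eq_one_sub (measurableSet_le hZ measurable_const)

lemma antitone_toReal_prob_gt (P : Measure Ω) [IsProbabilityMeasure P] (Z : Ω → ℝ) :
    Antitone fun x : ℝ => (P {ω | Z ω > x}).toReal := fun x y hxy =>
  ENNReal.toReal_mono (measure_ne_top _ _)
    (measure_mono fun ω (hω : Z ω > y) => show Z ω > x from lt_of_le_of_lt hxy hω)

lemma monotone_toReal_prob_le (P : Measure Ω) [IsProbabilityMeasure P] (Z : Ω → ℝ) :
    Monotone fun x : ℝ => (P {ω | Z ω ≤ x}).toReal := fun x y hxy =>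
  ENNReal.toReal_mono (measure_ne_top _ _)
    (measure_mono fun ω (hω : Z ω ≤ x) => show Z ω ≤ y from hω.trans hxy)

lemma distExp_eq_intervalIntegral (P : Measure Ω) [IsProbabilityMeasure P] {h H : ℝ → ℝ}
    (hhH : ∀ y ∈ Icc (0 : ℝ) 1, h y = H y) (hH : Monotone H) (H0 : H 0 = 0) (H1 : H 1 = 1)
    {Z : Ω → ℝ} {M : ℝ} (hM : 0 ≤ M) (hZ : ∀ ω, |Z ω| ≤ M) :
    distExp P h Z = (∫ x in (-M)..M, H (P {ω | Z ω > x}).toReal) - M := by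
  have hanti : Antitone fun x : ℝ => H (P {ω | Z ω > x}).toReal :=
    hH.comp_antitone (antitone_toReal_prob_gt P Z)
  have top : ∀ x, M < x → H (P {ω | Z ω > x}).toReal = 0 := by
    intro x hx
    have : {ω | Z ω > x} = ∅ := by
      ext ω
      have := (abs_le.1 (hZ ω)).2
      simp only [mem_ofPred_eq, mem_empty_iff_false, iff_false, not_lt]
      linarith
    simp [this, H0]
  have bot : ∀ x, x < -M → H (P {ω | Z ω > x}).toReal = 1 := by
    intro x hx
    have : {ω | Z ω > x} = univ := by
      ext ω
      have := (abs_le.1 (hZ ω)).1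
      simp only [mem_ofPred_eq, mem_univ, iff_true]
      linarith
    simp [this, H1]
  have e1 : ∫ x in Ioi (0:ℝ), H (P {ω | Z ω > x}).toReal =
      ∫ x in (0:ℝ)..M, H (P {ω | Z ω > x}).toReal := by
    rw [intervalIntegral.integral_of_le hM]
    refine setIntegral_eq_of_subset_of_forall_sdiff_eq_zero measurableSet_Ioi
      (fun x hx => hx.1) fun x hx => top x ?_
    by_contra hc
    exact hx.2 ⟨hx.1, not_lt.1 hc⟩
  have e2 : ∫ x in Iio (0:ℝ), (H (P {ω | Z ω > x}).toReal - 1) =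
      ∫ x in (-M)..0, (H (P {ω | Z ω > x}).toReal - 1) := by
    rw [intervalIntegral.integral_of_le (neg_nonpos.2 hM), integral_Ioc_eq_integral_Ioo,
      ← integral_Ico_eq_integral_Ioo]
    refine setIntegral_eq_of_subset_of_forall_sdiff_eq_zero measurableSet_Iio
      (fun x hx => hx.2) fun x hx => sub_eq_zero.2 (bot x ?_)
    by_contra hc
    exact hx.2 ⟨not_lt.1 hc, hx.1⟩
  rw [intervalIntegral.integral_sub hanti.intervalIntegrable (by simp)] at e2
  unfold distExp
  simp_rw [hhH _ (toReal_prob_mem_Icc P _)]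
  rw [e1, e2, ← intervalIntegral.integral_add_adjacent_intervals (a := -M) (b := 0) (c := M)
    hanti.intervalIntegrable hanti.intervalIntegrable]
  simp only [intervalIntegral.integral_const, smul_eq_mul]
  ring

lemma toReal_prob_gt_gt (P : Measure Ω) [IsProbabilityMeasure P] {X Y : Ω → ℝ}
    (hX : Measurable X) (hY : Measurable Y) (x y : ℝ) :
    (P {ω | X ω > x ∧ Y ω > y}).toReal = 1 - (P {ω | X ω ≤ x}).toReal - (P {ω | Y ω ≤ y}).toReal
      + (P {ω | X ω ≤ x ∧ Y ω ≤ y}).toReal := by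
  have mX : MeasurableSet {ω | X ω ≤ x} := measurableSet_le hX measurable_const
  have mY : MeasurableSet {ω | Y ω ≤ y} := measurableSet_le hY measurable_const
  have h1 : {ω | X ω > x ∧ Y ω > y} = ({ω | X ω ≤ x} ∪ {ω | Y ω ≤ y})ᶜ := by
    ext; simp
  have h2 := measureReal_union_add_inter (μ := P) (s := {ω | X ω ≤ x}) mY
  have h3 := probReal_compl_eq_one_sub (μ := P) (mX.union mY)
  rw [← h1] at h3
  simp only [Measure.real] at h2 h3
  rw [h3]
  have h4 : {ω | X ω ≤ x ∧ Y ω ≤ y} = {ω | X ω ≤ x} ∩ {ω | Y ω ≤ y} := rfl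
  rw [h4]
  linarith

/-- The integrated survival function of a sum, in terms of the joint survival function. -/
lemma lintegral_prob_add_gt (P : Measure Ω) [IsProbabilityMeasure P] {X Y : Ω → ℝ}
    (hX : Measurable X) (hY : Measurable Y) (t : ℝ) :
    ∫⁻ x in Ioi t, P {ω | X ω + Y ω > x} = ∫⁻ z, P {ω | X ω > z ∧ Y ω > t - z} := by
  have m1 : MeasurableSet {z : Ω × ℝ | X z.1 + Y z.1 > z.2} :=
    measurableSet_lt measurable_snd ((hX.comp measurable_fst).add (hY.comp measurable_fst))
  have m2 : MeasurableSet {z : Ω × ℝ | X z.1 > z.2 ∧ Y z.1 > t - z.2} :=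
    (measurableSet_lt measurable_snd (hX.comp measurable_fst)).inter
      (measurableSet_lt (measurable_const.sub measurable_snd) (hY.comp measurable_fst))
  have a1 := (Measure.prod_apply_symm (μ := P) (ν := volume.restrict (Ioi t)) m1).symm.trans
    (Measure.prod_apply m1)
  have a2 := (Measure.prod_apply_symm (μ := P) (ν := volume) m2).symm.trans
    (Measure.prod_apply m2)
  refine a1.trans (Eq.trans ?_ a2.symm)
  refine lintegral_congr fun ω => ?_
  rw [Measure.restrict_apply (measurable_prodMk_left m1)]
  have i1 : Prod.mk ω ⁻¹' {z : Ω × ℝ | X z.1 + Y z.1 > z.2} ∩ Ioi t = Ioo t (X ω + Y ω) := by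
    ext x
    simp [and_comm]
  have i2 : Prod.mk ω ⁻¹' {z : Ω × ℝ | X z.1 > z.2 ∧ Y z.1 > t - z.2} =
      Ioo (t - Y ω) (X ω) := by
    ext x
    simp only [mem_preimage, mem_ofPred_eq, mem_Ioo]
    constructor <;> rintro ⟨h1, h2⟩ <;> constructor <;> linarith
  rw [i1, i2, Real.volume_Ioo, Real.volume_Ioo]
  congr 1
  ring

/-- The integrated distribution function of a sum, in terms of the joint distribution function. -/
lemma lintegral_prob_add_le (P : Measure Ω) [IsProbabilityMeasure P] {X Y : Ω → ℝ}
    (hX : Measurable X) (hY : Measurable Y) (t : ℝ) :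
    ∫⁻ x in Iio t, P {ω | X ω + Y ω ≤ x} = ∫⁻ z, P {ω | X ω ≤ z ∧ Y ω ≤ t - z} := by
  have m1 : MeasurableSet {z : Ω × ℝ | X z.1 + Y z.1 ≤ z.2} :=
    measurableSet_le ((hX.comp measurable_fst).add (hY.comp measurable_fst)) measurable_snd
  have m2 : MeasurableSet {z : Ω × ℝ | X z.1 ≤ z.2 ∧ Y z.1 ≤ t - z.2} :=
    (measurableSet_le (hX.comp measurable_fst) measurable_snd).inter
      (measurableSet_le (hY.comp measurable_fst) (measurable_const.sub measurable_snd))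
  have a1 := (Measure.prod_apply_symm (μ := P) (ν := volume.restrict (Iio t)) m1).symm.trans
    (Measure.prod_apply m1)
  have a2 := (Measure.prod_apply_symm (μ := P) (ν := volume) m2).symm.trans
    (Measure.prod_apply m2)
  refine a1.trans (Eq.trans ?_ a2.symm)
  refine lintegral_congr fun ω => ?_
  rw [Measure.restrict_apply (measurable_prodMk_left m1)]
  have i1 : Prod.mk ω ⁻¹' {z : Ω × ℝ | X z.1 + Y z.1 ≤ z.2} ∩ Iio t = Ico (X ω + Y ω) t := by
    ext x
    simp
  have i2 : Prod.mk ω ⁻¹' {z : Ω × ℝ | X z.1 ≤ z.2 ∧ Y z.1 ≤ t - z.2} =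
      Icc (X ω) (t - Y ω) := by
    ext x
    simp only [mem_preimage, mem_ofPred_eq, mem_Icc]
    constructor <;> rintro ⟨h1, h2⟩ <;> constructor <;> linarith
  rw [i1, i2, Real.volume_Ico, Real.volume_Icc]
  congr 1
  ring

lemma integral_prob_gt_eq_lintegral (P : Measure Ω) [IsProbabilityMeasure P] {Z : Ω → ℝ} {M t : ℝ}
    (hZ : ∀ ω, |Z ω| ≤ M) (ht : t ≤ M) :
    ENNReal.ofReal (∫ x in t..M, (P {ω | Z ω > x}).toReal) = ∫⁻ x in Ioi t, P {ω | Z ω > x} := by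
  have hint : IntervalIntegrable (fun x => (P {ω | Z ω > x}).toReal) volume t M :=
    (antitone_toReal_prob_gt P Z).intervalIntegrable
  rw [intervalIntegral.integral_of_le ht, ofReal_integral_eq_lintegral_ofReal
    ((intervalIntegrable_iff_integrableOn_Ioc_of_le ht).1 hint)
    (.of_forall fun _ => ENNReal.toReal_nonneg)]
  simp_rw [ENNReal.ofReal_toReal (measure_ne_top P _)]
  rw [← Ioc_union_Ioi_eq_Ioi ht, lintegral_union measurableSet_Ioi
    (Ioc_disjoint_Ioi_same)]
  have : ∫⁻ x in Ioi M, P {ω | Z ω > x} = 0 := by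
    rw [setLIntegral_congr_fun (g := fun _ => 0) measurableSet_Ioi, lintegral_zero]
    intro x hx
    have : {ω | Z ω > x} = ∅ := by
      ext ω
      have := (abs_le.1 (hZ ω)).2
      have : M < x := hx
      simp only [mem_ofPred_eq, mem_empty_iff_false, iff_false, not_lt]
      linarith
    simp [this]
  rw [this, add_zero]

lemma integral_prob_le_eq_lintegral (P : Measure Ω) [IsProbabilityMeasure P] {Z : Ω → ℝ} {M t : ℝ}
    (hZ : ∀ ω, |Z ω| ≤ M) (ht : -M ≤ t) :
    ENNReal.ofReal (∫ x in (-M)..t, (P {ω | Z ω ≤ x}).toReal) =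
      ∫⁻ x in Iio t, P {ω | Z ω ≤ x} := by
  have hint : IntervalIntegrable (fun x => (P {ω | Z ω ≤ x}).toReal) volume (-M) t :=
    (monotone_toReal_prob_le P Z).intervalIntegrable
  rw [intervalIntegral.integral_of_le ht, ofReal_integral_eq_lintegral_ofReal
    ((intervalIntegrable_iff_integrableOn_Ioc_of_le ht).1 hint)
    (.of_forall fun _ => ENNReal.toReal_nonneg)]
  simp_rw [ENNReal.ofReal_toReal (measure_ne_top P _)]
  rw [setLIntegral_congr (Ico_ae_eq_Ioc (μ := volume) (a := -M) (b := t)).symm,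
    ← Iio_union_Ico_eq_Iio ht, lintegral_union measurableSet_Ico
    (by rw [disjoint_left]; intro x hx hx'; exact absurd hx'.1 (not_le.2 hx))]
  have : ∫⁻ x in Iio (-M), P {ω | Z ω ≤ x} = 0 := by
    rw [setLIntegral_congr_fun (g := fun _ => 0) measurableSet_Iio, lintegral_zero]
    intro x hx
    have : {ω | Z ω ≤ x} = ∅ := by
      ext ω
      have := (abs_le.1 (hZ ω)).1
      have : x < -M := hx
      simp only [mem_ofPred_eq, mem_empty_iff_false, iff_false, not_le]
      linarith
    simp [this]
  rw [this, zero_add]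

/-! ### Copulas fixing `(1 - p, 1 - p)` -/

lemma IsCopula.nonneg {C : ℝ → ℝ → ℝ} (hC : IsCopula C) {u v : ℝ} (hu : u ∈ Icc (0:ℝ) 1)
    (hv : v ∈ Icc (0:ℝ) 1) : 0 ≤ C u v := by
  have := hC.2 0 u 0 v (by simp) hu (by simp) hv hu.1 hv.1
  linarith [(hC.1 u hu).1, (hC.1 v hv).2.1, (hC.1 0 (by simp)).1]

lemma IsCopula.le_left {C : ℝ → ℝ → ℝ} (hC : IsCopula C) {u v : ℝ} (hu : u ∈ Icc (0:ℝ) 1)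
    (hv : v ∈ Icc (0:ℝ) 1) : C u v ≤ u := by
  have := hC.2 0 u v 1 (by simp) hu hv (by simp) hu.1 hv.2
  linarith [(hC.1 u hu).2.2.1, (hC.1 v hv).2.1, (hC.1 1 (by simp)).2.1]

lemma IsCopula.le_right {C : ℝ → ℝ → ℝ} (hC : IsCopula C) {u v : ℝ} (hu : u ∈ Icc (0:ℝ) 1)
    (hv : v ∈ Icc (0:ℝ) 1) : C u v ≤ v := by
  have := hC.2 u 1 0 v hu (by simp) (by simp) hv hu.2 hv.1
  linarith [(hC.1 v hv).2.2.2, (hC.1 u hu).1, (hC.1 1 (by simp)).1]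

lemma IsCopula.add_sub_one_le {C : ℝ → ℝ → ℝ} (hC : IsCopula C) {u v : ℝ}
    (hu : u ∈ Icc (0:ℝ) 1) (hv : v ∈ Icc (0:ℝ) 1) : u + v - 1 ≤ C u v := by
  have := hC.2 u 1 v 1 hu (by simp) hv (by simp) hu.2 hv.2
  linarith [(hC.1 v hv).2.2.2, (hC.1 u hu).2.2.1, (hC.1 1 (by simp)).2.2.1]

lemma IsCopula.mono {C : ℝ → ℝ → ℝ} (hC : IsCopula C) {u u' v v' : ℝ}
    (hu : u ∈ Icc (0:ℝ) 1) (hv : v ∈ Icc (0:ℝ) 1) (hu' : u' ∈ Icc (0:ℝ) 1)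
    (hv' : v' ∈ Icc (0:ℝ) 1) (huu : u ≤ u') (hvv : v ≤ v') : C u v ≤ C u' v' := by
  have h1 := hC.2 u u' 0 v hu hu' (by simp) hv huu hv.1
  have h2 := hC.2 0 u' v v' (by simp) hu' hv hv' hu'.1 hvv
  linarith [(hC.1 u hu).1, (hC.1 u' hu').1, (hC.1 v hv).2.1, (hC.1 v' hv').2.1]

lemma Cpm_le_of_mem_copulaSet {C : ℝ → ℝ → ℝ} {p : ℝ} (hp : p ∈ Ioo (0:ℝ) 1)
    (hC : C ∈ copulaSet p) {u v : ℝ} (hu : u ∈ Icc (0:ℝ) 1) (hv : v ∈ Icc (0:ℝ) 1)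
    (huv : 1 - p ≤ u ∨ 1 - p ≤ v) : Cpm p u v ≤ C u v := by
  obtain ⟨hC, hq⟩ := hC
  have hqm : 1 - p ∈ Icc (0:ℝ) 1 := ⟨by linarith [hp.2], by linarith [hp.1]⟩
  have diag : ∀ w ∈ Icc (0:ℝ) 1, w ≤ 1 - p → C w (1 - p) = w ∧ C (1 - p) w = w := by
    intro w hw hwq
    have h1 := hC.2 w (1 - p) (1 - p) 1 hw hqm hqm (by simp) hwq hqm.2
    have h2 := hC.2 (1 - p) 1 w (1 - p) hqm (by simp) hw hqm hqm.2 hwq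
    have := hC.le_left hw hqm
    have := hC.le_right hqm hw
    have := (hC.1 _ hqm).2.2
    have := (hC.1 _ hw).2.2
    constructor <;> linarith
  unfold Cpm
  split_ifs with h
  · rcases min_le_iff.1 h with h | h
    · rcases huv with h' | h'
      · have : u = 1 - p := le_antisymm h h'
        rcases le_total v (1 - p) with hv' | hv'
        · rw [this, (diag v hv hv').2]; exact min_le_right _ _
        · have := hC.mono hu hqm hu hv le_rfl hv'
          rw [(diag u hu h).1] at this
          exact (min_le_left _ _).trans this
      · have := hC.mono hu hqm hu hv le_rfl h'
        rw [(diag u hu h).1] at this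
        exact (min_le_left _ _).trans this
    · rcases huv with h' | h'
      · have := hC.mono hqm hv hu hv h' le_rfl
        rw [(diag v hv h).2] at this
        exact (min_le_right _ _).trans this
      · have : v = 1 - p := le_antisymm h h'
        rcases le_total u (1 - p) with hu' | hu'
        · rw [this, (diag u hu hu').1]; exact min_le_left _ _
        · have := hC.mono hqm hv hu hv hu' le_rfl
          rw [(diag v hv h).2] at this
          exact (min_le_right _ _).trans this
  · obtain ⟨h1, h2⟩ := lt_min_iff.1 (not_le.1 h)
    refine max_le (hC.add_sub_one_le hu hv) ?_
    have := hC.mono hqm hqm hu hv h1.le h2.le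
    linarith

lemma le_Cpm_of_mem_copulaSet {C : ℝ → ℝ → ℝ} {p : ℝ}
    (hC : C ∈ copulaSet p) {u v : ℝ} (hu : u ∈ Icc (0:ℝ) 1) (hv : v ∈ Icc (0:ℝ) 1)
    (huv : u ≤ 1 - p ∨ v ≤ 1 - p) : C u v ≤ Cpm p u v := by
  unfold Cpm
  rw [if_pos (min_le_iff.2 huv)]
  exact le_min (hC.1.le_left hu hv) (hC.1.le_right hu hv)

lemma Cpm_mem_copulaSet {p : ℝ} (hp : p ∈ Ioo (0:ℝ) 1) : Cpm p ∈ copulaSet p := by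
  have hp0 := hp.1
  have hp1 := hp.2
  have repr : ∀ u ∈ Icc (0:ℝ) 1, ∀ v ∈ Icc (0:ℝ) 1, Cpm p u v =
      min (min u (1 - p)) (min v (1 - p)) +
        max (max u (1 - p) + max v (1 - p) - (2 - p)) 0 := by
    rintro u ⟨hu0, hu1⟩ v ⟨hv0, hv1⟩
    unfold Cpm
    grind
  have two_min : ∀ a₁ a₂ b₁ b₂ : ℝ, a₁ ≤ a₂ → b₁ ≤ b₂ →
      0 ≤ min a₂ b₂ - min a₂ b₁ - min a₁ b₂ + min a₁ b₁ := by
    intro a₁ a₂ b₁ b₂ _ _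
    grind
  have two_max : ∀ a₁ a₂ b₁ b₂ c : ℝ, a₁ ≤ a₂ → b₁ ≤ b₂ →
      0 ≤ max (a₂ + b₂ - c) 0 - max (a₂ + b₁ - c) 0 - max (a₁ + b₂ - c) 0
        + max (a₁ + b₁ - c) 0 := by
    intro a₁ a₂ b₁ b₂ c _ _
    grind
  refine ⟨⟨?_, ?_⟩, ?_⟩
  · clear repr two_min two_max
    rintro u ⟨hu0, hu1⟩
    unfold Cpm
    refine ⟨?_, ?_, ?_, ?_⟩
    · rw [min_eq_right hu0, if_pos (by linarith)]
    · rw [min_eq_left hu0, if_pos (by linarith)]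
    · rw [min_eq_left hu1]
      split_ifs with h
      · rfl
      · rw [add_sub_cancel_right, max_eq_left (not_le.1 h).le]
    · rw [min_eq_right hu1]
      split_ifs with h
      · rfl
      · rw [add_sub_cancel_left, max_eq_left (not_le.1 h).le]
  · intro u₁ u₂ v₁ v₂ hu₁ hu₂ hv₁ hv₂ hu hv
    rw [repr _ hu₁ _ hv₁, repr _ hu₁ _ hv₂, repr _ hu₂ _ hv₁, repr _ hu₂ _ hv₂]
    have h1 := two_min _ _ _ _ (min_le_min_right (1 - p) hu) (min_le_min_right (1 - p) hv)
    have h2 := two_max _ _ _ _ (2 - p) (max_le_max_right (1 - p) hu) (max_le_max_right (1 - p) hv)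
    linarith
  · simp [Cpm]

/-! ### Optimality -/

lemma exists_quantile (P : Measure Ω) [IsProbabilityMeasure P] {X : Ω → ℝ} {M q : ℝ}
    (hM : ∀ ω, |X ω| ≤ M) (hq : q ∈ Ioo (0:ℝ) 1) :
    ∃ a, |a| ≤ M ∧ (∀ z, a < z → q ≤ (P {ω | X ω ≤ z}).toReal) ∧
      ∀ z, z < a → (P {ω | X ω ≤ z}).toReal ≤ q := by
  let s : Set ℝ := {z | q ≤ (P {ω | X ω ≤ z}).toReal}
  have hMs : M ∈ s := by
    have : {ω | X ω ≤ M} = univ := by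
      ext ω
      simp [(abs_le.1 (hM ω)).2]
    show q ≤ (P {ω | X ω ≤ M}).toReal
    rw [this]
    simpa using hq.2.le
  have hlow : ∀ z ∈ s, -M ≤ z := by
    intro z hz
    by_contra hc
    have : {ω | X ω ≤ z} = ∅ := by
      ext ω
      have := (abs_le.1 (hM ω)).1
      simp only [mem_ofPred_eq, mem_empty_iff_false, iff_false, not_le]
      linarith
    have hz : q ≤ (P {ω | X ω ≤ z}).toReal := hz
    rw [this] at hz
    simp only [measure_empty, ENNReal.toReal_zero] at hz
    linarith [hq.1]
  have hbdd : BddBelow s := ⟨-M, hlow⟩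
  refine ⟨sInf s, abs_le.2 ⟨le_csInf ⟨M, hMs⟩ hlow, csInf_le hbdd hMs⟩, ?_, ?_⟩
  · intro z hz
    obtain ⟨y, hy, hyz⟩ := exists_lt_of_csInf_lt ⟨M, hMs⟩ hz
    exact le_trans hy (monotone_toReal_prob_le P X hyz.le)
  · intro z hz
    by_contra hc
    exact absurd (csInf_le hbdd (show z ∈ s from (not_le.1 hc).le)) (not_le.2 hz)

lemma prob_add_gt_le_of_mem_copulaSet (P : Measure Ω) [IsProbabilityMeasure P] {X Y : Ω → ℝ}
    (hX : Measurable X) (hY : Measurable Y) {C : ℝ → ℝ → ℝ} {p a b x : ℝ}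
    (hp : p ∈ Ioo (0:ℝ) 1) (hC : C ∈ copulaSet p) (hXY : HasCopula P X Y C)
    (ha : ∀ z, a < z → 1 - p ≤ (P {ω | X ω ≤ z}).toReal)
    (hb : ∀ z, b < z → 1 - p ≤ (P {ω | Y ω ≤ z}).toReal) (hx : a + b < x) :
    (P {ω | X ω + Y ω > x}).toReal ≤ p := by
  have hqm : 1 - p ∈ Icc (0:ℝ) 1 := ⟨by linarith [hp.2], by linarith [hp.1]⟩
  have h1 := ha (a + (x - a - b) / 2) (by linarith)
  have h2 := hb (b + (x - a - b) / 2) (by linarith)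
  have h3 := hC.1.mono hqm hqm (toReal_prob_mem_Icc P _) (toReal_prob_mem_Icc P _) h1 h2
  rw [hC.2, ← hXY] at h3
  have h4 : (P {ω | X ω ≤ a + (x - a - b) / 2 ∧ Y ω ≤ b + (x - a - b) / 2}).toReal ≤
      (P {ω | X ω + Y ω ≤ x}).toReal :=
    ENNReal.toReal_mono (measure_ne_top _ _) (measure_mono fun ω hω => by
      have := hω.1
      have := hω.2
      show X ω + Y ω ≤ x
      linarith)
  rw [toReal_prob_gt P (Z := fun ω => X ω + Y ω) (hX.add hY)]
  linarith

lemma prob_add_le_le_of_mem_copulaSet (P : Measure Ω) [IsProbabilityMeasure P] {X Y : Ω → ℝ}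
    (hX : Measurable X) (hY : Measurable Y) {C : ℝ → ℝ → ℝ} {p a b x : ℝ}
    (hp : p ∈ Ioo (0:ℝ) 1) (hC : C ∈ copulaSet p) (hXY : HasCopula P X Y C)
    (ha : ∀ z, z < a → (P {ω | X ω ≤ z}).toReal ≤ 1 - p)
    (hb : ∀ z, z < b → (P {ω | Y ω ≤ z}).toReal ≤ 1 - p) (hx : x < a + b) :
    (P {ω | X ω + Y ω ≤ x}).toReal ≤ 1 - p := by
  have hqm : 1 - p ∈ Icc (0:ℝ) 1 := ⟨by linarith [hp.2], by linarith [hp.1]⟩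
  have h1 := ha (a - (a + b - x) / 2) (by linarith)
  have h2 := hb (b - (a + b - x) / 2) (by linarith)
  have mu := toReal_prob_mem_Icc P {ω | X ω ≤ a - (a + b - x) / 2}
  have mv := toReal_prob_mem_Icc P {ω | Y ω ≤ b - (a + b - x) / 2}
  have h3 := hC.1.2 _ _ _ _ mu hqm mv hqm h1 h2
  have h5 := hC.1.le_right hqm mv
  have h6 := hC.1.le_left mu hqm
  rw [hC.2, ← hXY] at h3
  have h7 := toReal_prob_gt_gt P hX hY (a - (a + b - x) / 2) (b - (a + b - x) / 2)
  have h4 : (P {ω | X ω > a - (a + b - x) / 2 ∧ Y ω > b - (a + b - x) / 2}).toReal ≤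
      (P {ω | X ω + Y ω > x}).toReal :=
    ENNReal.toReal_mono (measure_ne_top _ _) (measure_mono fun ω hω => by
      have := hω.1
      have := hω.2
      show x < X ω + Y ω
      linarith)
  rw [toReal_prob_gt P (Z := fun ω => X ω + Y ω) (hX.add hY)] at h4
  have e1 : C (P {ω | X ω ≤ a - (a + b - x) / 2}).toReal (1 - p) =
      (P {ω | X ω ≤ a - (a + b - x) / 2}).toReal := by
    refine le_antisymm h6 ?_
    have := Cpm_le_of_mem_copulaSet hp hC mu hqm (Or.inr le_rfl)
    rw [Cpm, if_pos (min_le_right _ _), min_eq_left h1] at this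
    exact this
  have e2 : C (1 - p) (P {ω | Y ω ≤ b - (a + b - x) / 2}).toReal =
      (P {ω | Y ω ≤ b - (a + b - x) / 2}).toReal := by
    refine le_antisymm h5 ?_
    have := Cpm_le_of_mem_copulaSet hp hC hqm mv (Or.inl le_rfl)
    rw [Cpm, if_pos (min_le_left _ _), min_eq_right h2] at this
    exact this
  linarith


lemma IsDistortion.exists_extension {h : ℝ → ℝ} {p : ℝ} (hdist : IsDistortion h)
    (hp : p ∈ Ioo (0:ℝ) 1) (hiss : IsISS h p) :
    ∃ H : ℝ → ℝ, (∀ y ∈ Icc (0:ℝ) 1, h y = H y) ∧ Monotone H ∧ Continuous H ∧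
      H 0 = 0 ∧ H 1 = 1 ∧ ConcaveOn ℝ (Icc 0 p) H ∧ ConvexOn ℝ (Icc p 1) H := by
  obtain ⟨hmono, h0, h1⟩ := hdist
  obtain ⟨hcont, hcc, hcv⟩ := hiss
  have hext : ∀ y ∈ Icc (0:ℝ) 1, h y = IccExtend zero_le_one (domRestrict (Icc (0:ℝ) 1) h) y := by
    intro y hy
    rw [IccExtend_of_mem _ _ hy]
    rfl
  have hsub0 : Icc 0 p ⊆ Icc (0:ℝ) 1 := Icc_subset_Icc_right hp.2.le
  have hsub1 : Icc p 1 ⊆ Icc (0:ℝ) 1 := Icc_subset_Icc_left hp.1.le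
  refine ⟨IccExtend zero_le_one (domRestrict (Icc (0:ℝ) 1) h), hext, ?_, ?_, ?_, ?_, ?_, ?_⟩
  · refine Monotone.IccExtend _ fun x y hxy => hmono x.2 y.2 hxy
  · exact (continuousOn_iff_continuous_domRestrict.1 hcont).Icc_extend'
  · rw [← hext 0 (by simp), h0]
  · rw [← hext 1 (by simp), h1]
  · exact (ConcaveOn.Icc_of_Ioo hp.1 (hcont.mono hsub0) hcc).congr fun y hy => hext y (hsub0 hy)
  · have := (ConcaveOn.Icc_of_Ioo hp.2 (hcont.mono hsub1).neg hcv.neg).neg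
    rw [neg_neg] at this
    exact this.congr fun y hy => hext y (hsub1 hy)

/-- In a copula pairing with `C^±_p`, the upper part of the sum is dominated. -/
lemma lintegral_prob_add_gt_le (P : Measure Ω) [IsProbabilityMeasure P] {X Y X' Y' : Ω → ℝ}
    (hX : Measurable X) (hY : Measurable Y) (hX' : Measurable X') (hY' : Measurable Y')
    {C : ℝ → ℝ → ℝ} {p a b t : ℝ} (hp : p ∈ Ioo (0:ℝ) 1) (hC : C ∈ copulaSet p)
    (hXY : HasCopula P X Y (Cpm p)) (hXY' : HasCopula P X' Y' C)
    (hF : ∀ z, P {ω | X ω ≤ z} = P {ω | X' ω ≤ z})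
    (hG : ∀ z, P {ω | Y ω ≤ z} = P {ω | Y' ω ≤ z})
    (ha : ∀ z, a < z → 1 - p ≤ (P {ω | X ω ≤ z}).toReal)
    (hb : ∀ z, b < z → 1 - p ≤ (P {ω | Y ω ≤ z}).toReal) (ht : a + b ≤ t) :
    ∫⁻ x in Ioi t, P {ω | X ω + Y ω > x} ≤ ∫⁻ x in Ioi t, P {ω | X' ω + Y' ω > x} := by
  rw [lintegral_prob_add_gt P hX hY, lintegral_prob_add_gt P hX' hY']
  refine lintegral_mono_ae ?_
  filter_upwards [Measure.ae_ne volume a] with z hz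
  rw [← ENNReal.toReal_le_toReal (measure_ne_top _ _) (measure_ne_top _ _),
    toReal_prob_gt_gt P hX hY, toReal_prob_gt_gt P hX' hY', hXY, hXY', ← hF, ← hG]
  have := Cpm_le_of_mem_copulaSet hp hC (toReal_prob_mem_Icc P {ω | X ω ≤ z})
    (toReal_prob_mem_Icc P {ω | Y ω ≤ t - z}) (by
      rcases lt_or_gt_of_ne hz with h | h
      · exact Or.inr (hb _ (by linarith))
      · exact Or.inl (ha _ h))
  linarith

lemma lintegral_prob_add_le_le (P : Measure Ω) [IsProbabilityMeasure P] {X Y X' Y' : Ω → ℝ}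
    (hX : Measurable X) (hY : Measurable Y) (hX' : Measurable X') (hY' : Measurable Y')
    {C : ℝ → ℝ → ℝ} {p a b t : ℝ} (hC : C ∈ copulaSet p)
    (hXY : HasCopula P X Y (Cpm p)) (hXY' : HasCopula P X' Y' C)
    (hF : ∀ z, P {ω | X ω ≤ z} = P {ω | X' ω ≤ z})
    (hG : ∀ z, P {ω | Y ω ≤ z} = P {ω | Y' ω ≤ z})
    (ha : ∀ z, z < a → (P {ω | X ω ≤ z}).toReal ≤ 1 - p)
    (hb : ∀ z, z < b → (P {ω | Y ω ≤ z}).toReal ≤ 1 - p) (ht : t ≤ a + b) :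
    ∫⁻ x in Iio t, P {ω | X' ω + Y' ω ≤ x} ≤ ∫⁻ x in Iio t, P {ω | X ω + Y ω ≤ x} := by
  rw [lintegral_prob_add_le P hX hY, lintegral_prob_add_le P hX' hY']
  refine lintegral_mono_ae ?_
  filter_upwards [Measure.ae_ne volume a] with z hz
  rw [← ENNReal.toReal_le_toReal (measure_ne_top _ _) (measure_ne_top _ _),
    hXY, hXY', ← hF, ← hG]
  refine le_Cpm_of_mem_copulaSet hC (toReal_prob_mem_Icc P {ω | X ω ≤ z})
    (toReal_prob_mem_Icc P {ω | Y ω ≤ t - z}) ?_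
  rcases lt_or_gt_of_ne hz with h | h
  · exact Or.inl (ha _ h)
  · exact Or.inr (hb _ (by linarith))

theorem Cpm_univOptimalWithin (P : Measure Ω) [IsProbabilityMeasure P] {h : ℝ → ℝ} {p : ℝ}
    (hdist : IsDistortion h) (hp : p ∈ Ioo (0:ℝ) 1) (hiss : IsISS h p) :
    UnivOptimalWithin P h (Cpm p) (copulaSet p) := by
  rintro X Y X' Y' ⟨hX, MX, hMX⟩ ⟨hY, MY, hMY⟩ ⟨hX', MX', hMX'⟩ ⟨hY', MY', hMY'⟩ hXY
    ⟨C, hC, hXY'⟩ hXX hYY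
  obtain ⟨H, hhH, Hmono, Hcont, H0, H1, Hcc, Hcv⟩ := hdist.exists_extension hp hiss
  have hq : 1 - p ∈ Ioo (0:ℝ) 1 := ⟨by linarith [hp.2], by linarith [hp.1]⟩
  have hF : ∀ z, P {ω | X ω ≤ z} = P {ω | X' ω ≤ z} :=
    fun z => hXX.measure_mem_eq (s := Iic z) measurableSet_Iic
  have hG : ∀ z, P {ω | Y ω ≤ z} = P {ω | Y' ω ≤ z} :=
    fun z => hYY.measure_mem_eq (s := Iic z) measurableSet_Iic
  have hF' : ∀ z, (P {ω | X' ω ≤ z}).toReal = (P {ω | X ω ≤ z}).toReal := fun z => by rw [hF]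
  have hG' : ∀ z, (P {ω | Y' ω ≤ z}).toReal = (P {ω | Y ω ≤ z}).toReal := fun z => by rw [hG]
  obtain ⟨a, haM, ha1, ha2⟩ := exists_quantile P hMX hq
  obtain ⟨b, hbM, hb1, hb2⟩ := exists_quantile P hMY hq
  obtain ⟨M, hM0, hs, hM, hM'⟩ : ∃ M, 0 ≤ M ∧ |a + b| ≤ M ∧ (∀ ω, |X ω + Y ω| ≤ M) ∧
      ∀ ω, |X' ω + Y' ω| ≤ M := by
    have h1 := (abs_nonneg a).trans haM
    have h2 := (abs_nonneg b).trans hbM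
    refine ⟨max (MX + MY) (MX' + MY'), le_max_of_le_left (by linarith),
      le_max_of_le_left ((abs_add_le _ _).trans (by linarith)), fun ω => ?_, fun ω => ?_⟩
    · exact le_max_of_le_left ((abs_add_le _ _).trans (add_le_add (hMX ω) (hMY ω)))
    · exact le_max_of_le_right ((abs_add_le _ _).trans (add_le_add (hMX' ω) (hMY' ω)))
  obtain ⟨hs1, hs2⟩ := abs_le.1 hs
  have hS : Measurable fun ω => X ω + Y ω := hX.add hY
  have hS' : Measurable fun ω => X' ω + Y' ω := hX'.add hY'
  have hCpm := Cpm_mem_copulaSet hp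
  have hint : ∀ (Z : Ω → ℝ) (c d : ℝ),
      IntervalIntegrable (fun x => H (P {ω | Z ω > x}).toReal) volume c d := fun Z c d =>
    (Hmono.comp_antitone (antitone_toReal_prob_gt P Z)).intervalIntegrable
  have upper : ∫ x in (a + b)..M, H (P {ω | X ω + Y ω > x}).toReal ≤
      ∫ x in (a + b)..M, H (P {ω | X' ω + Y' ω > x}).toReal := by
    refine integral_comp_le_of_tail_le (f₁ := fun x => (P {ω | X ω + Y ω > x}).toReal)
      (f₂ := fun x => (P {ω | X' ω + Y' ω > x}).toReal) hs2 hp.1 Hmono Hcont Hcc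
      (antitone_toReal_prob_gt P _) (antitone_toReal_prob_gt P _) ?_ ?_ ?_
    · intro x hx
      exact ⟨ENNReal.toReal_nonneg,
        prob_add_gt_le_of_mem_copulaSet P hX hY hp hCpm hXY ha1 hb1 hx.1⟩
    · intro x hx
      refine ⟨ENNReal.toReal_nonneg,
        prob_add_gt_le_of_mem_copulaSet P hX' hY' hp hC hXY' ?_ ?_ hx.1⟩
      · simpa only [hF'] using ha1
      · simpa only [hG'] using hb1
    · intro t ht
      have hnn : 0 ≤ ∫ x in t..M, (P {ω | X' ω + Y' ω > x}).toReal :=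
        intervalIntegral.integral_nonneg ht.2 fun _ _ => ENNReal.toReal_nonneg
      rw [← ENNReal.ofReal_le_ofReal_iff hnn, integral_prob_gt_eq_lintegral P hM ht.2,
        integral_prob_gt_eq_lintegral P hM' ht.2]
      exact lintegral_prob_add_gt_le P hX hY hX' hY' hp hC hXY hXY' hF hG ha1 hb1 ht.1
  have lower : ∫ x in (-M)..(a + b), H (P {ω | X ω + Y ω > x}).toReal ≤
      ∫ x in (-M)..(a + b), H (P {ω | X' ω + Y' ω > x}).toReal := by
    have key := integral_comp_le_of_tail_le (H := fun y => 1 - H (1 - y))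
      (f₁ := fun x => (P {ω | X' ω + Y' ω ≤ -x}).toReal)
      (f₂ := fun x => (P {ω | X ω + Y ω ≤ -x}).toReal) (a := -(a + b)) (b := M) (p := 1 - p)
      (by linarith) hq.1 (fun x y hxy => sub_le_sub_left (Hmono (sub_le_sub_left hxy 1)) 1)
      (by fun_prop) ?_
      (fun x y hxy => monotone_toReal_prob_le P _ (neg_le_neg hxy))
      (fun x y hxy => monotone_toReal_prob_le P _ (neg_le_neg hxy)) ?_ ?_ ?_
    · simp only [← toReal_prob_gt P hS, ← toReal_prob_gt P hS'] at key
      rw [intervalIntegral.integral_comp_neg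
          (fun x => 1 - H (P {ω | X' ω + Y' ω > x}).toReal),
        intervalIntegral.integral_comp_neg
          (fun x => 1 - H (P {ω | X ω + Y ω > x}).toReal), neg_neg,
        intervalIntegral.integral_sub intervalIntegrable_const (hint _ _ _),
        intervalIntegral.integral_sub intervalIntegrable_const (hint _ _ _)] at key
      linarith
    · refine ⟨convex_Icc _ _, fun x hx y hy c d hc hd hcd => ?_⟩
      have := Hcv.2 (x := 1 - x) (y := 1 - y) ⟨by linarith [hx.2], by linarith [hx.1]⟩
        ⟨by linarith [hy.2], by linarith [hy.1]⟩ hc hd hcd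
      simp only [smul_eq_mul] at this ⊢
      have e : 1 - (c * x + d * y) = c * (1 - x) + d * (1 - y) := by
        linear_combination -hcd
      rw [e]
      linarith
    · intro x hx
      refine ⟨ENNReal.toReal_nonneg, prob_add_le_le_of_mem_copulaSet P hX' hY' hp hC hXY'
        (a := a) (b := b) ?_ ?_ (by linarith [hx.1])⟩
      · simpa only [hF'] using ha2
      · simpa only [hG'] using hb2
    · intro x hx
      exact ⟨ENNReal.toReal_nonneg, prob_add_le_le_of_mem_copulaSet P hX hY hp hCpm hXY
        ha2 hb2 (by linarith [hx.1])⟩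
    · intro t ht
      rw [intervalIntegral.integral_comp_neg (fun x => (P {ω | X' ω + Y' ω ≤ x}).toReal),
        intervalIntegral.integral_comp_neg (fun x => (P {ω | X ω + Y ω ≤ x}).toReal)]
      have ht' : -M ≤ -t := neg_le_neg ht.2
      have hnn : 0 ≤ ∫ x in (-M)..(-t), (P {ω | X ω + Y ω ≤ x}).toReal :=
        intervalIntegral.integral_nonneg ht' fun _ _ => ENNReal.toReal_nonneg
      rw [← ENNReal.ofReal_le_ofReal_iff hnn, integral_prob_le_eq_lintegral P hM ht',
        integral_prob_le_eq_lintegral P hM' ht']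
      exact lintegral_prob_add_le_le P hX hY hX' hY' hC hXY hXY' hF hG ha2 hb2
        (by linarith [ht.1])
  rw [distExp_eq_intervalIntegral P hhH Hmono H0 H1 hM0 hM,
    distExp_eq_intervalIntegral P hhH Hmono H0 H1 hM0 hM']
  rw [← intervalIntegral.integral_add_adjacent_intervals (hint _ (-M) (a + b)) (hint _ _ M),
    ← intervalIntegral.integral_add_adjacent_intervals (hint _ (-M) (a + b)) (hint _ _ M)]
  linarith

/-! ### Uniqueness -/

lemma AtomlessProb.exists_subset_measureReal_le {P : Measure Ω} [IsProbabilityMeasure P]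
    (hP : AtomlessProb P) {A : Set Ω} (hA : MeasurableSet A) (hA0 : 0 < P.real A) {ε : ℝ}
    (hε : 0 < ε) : ∃ B ⊆ A, MeasurableSet B ∧ 0 < P.real B ∧ P.real B ≤ ε := by
  have halving : ∀ n : ℕ, ∃ B ⊆ A, MeasurableSet B ∧ 0 < P.real B ∧
      P.real B ≤ (1 / 2 : ℝ) ^ n := by
    intro n
    induction n with
    | zero => exact ⟨A, subset_rfl, hA, hA0, by simp⟩
    | succ n ih =>
      obtain ⟨B, hBA, hB, hB0, hBn⟩ := ih
      obtain ⟨E, hEB, hE, hE0, hElt⟩ := hP B hB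
        (ENNReal.toReal_pos_iff.1 hB0).1
      have hE0' : 0 < P.real E := ENNReal.toReal_pos hE0.ne' (measure_ne_top _ _)
      have hElt' : P.real E < P.real B :=
        (ENNReal.toReal_lt_toReal (measure_ne_top _ _) (measure_ne_top _ _)).2 hElt
      have hdiff : P.real (B \ E) = P.real B - P.real E := measureReal_sdiff hEB hE
      rw [pow_succ]
      rcases le_total (P.real E) (P.real B / 2) with h | h
      · exact ⟨E, hEB.trans hBA, hE, hE0', by linarith⟩
      · exact ⟨B \ E, sdiff_subset.trans hBA, hB.diff hE, by linarith, by linarith⟩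
  obtain ⟨n, hn⟩ := exists_pow_lt_of_lt_one hε (by norm_num : (1 / 2 : ℝ) < 1)
  obtain ⟨B, hBA, hB, hB0, hBn⟩ := halving n
  exact ⟨B, hBA, hB, hB0, hBn.trans hn.le⟩

/-- Sierpiński's theorem: an atomless probability takes all intermediate values. -/
lemma AtomlessProb.exists_subset_measureReal_eq {P : Measure Ω} [IsProbabilityMeasure P]
    (hP : AtomlessProb P) {A : Set Ω} (hA : MeasurableSet A) {r : ℝ} (hr0 : 0 ≤ r)
    (hr : r ≤ P.real A) : ∃ B ⊆ A, MeasurableSet B ∧ P.real B = r := by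
  let T := {B : Set Ω // MeasurableSet B ∧ B ⊆ A ∧ P.real B ≤ r}
  have step : ∀ B : T, ∃ B' : T, B.1 ⊆ B'.1 ∧ ∀ E ⊆ A \ B.1, MeasurableSet E →
      P.real E ≤ r - P.real B.1 → P.real E ≤ 2 * (P.real B'.1 - P.real B.1) := by
    rintro ⟨B, hB, hBA, hBr⟩
    let V : Set ℝ := {x | ∃ E ⊆ A \ B, MeasurableSet E ∧ P.real E ≤ r - P.real B ∧ P.real E = x}
    have hV0 : (0 : ℝ) ∈ V := ⟨∅, empty_subset _, .empty, by simpa using hBr, by simp⟩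
    have hVb : BddAbove V := ⟨r - P.real B, by rintro _ ⟨E, -, -, h, rfl⟩; exact h⟩
    obtain ⟨E, hEs, hE, hEr, hEsup⟩ : ∃ E ⊆ A \ B, MeasurableSet E ∧
        P.real E ≤ r - P.real B ∧ sSup V ≤ 2 * P.real E := by
      rcases (le_csSup hVb hV0).eq_or_lt with h | h
      · exact ⟨∅, empty_subset _, .empty, by simpa using hBr, by simp [← h]⟩
      · obtain ⟨_, ⟨E, h1, h2, h3, rfl⟩, h4⟩ := exists_lt_of_lt_csSup ⟨0, hV0⟩ (half_lt_self h)
        exact ⟨E, h1, h2, h3, by linarith⟩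
    have hun : P.real (B ∪ E) = P.real B + P.real E :=
      measureReal_union (disjoint_sdiff_right.mono_right hEs) hE
    refine ⟨⟨B ∪ E, hB.union hE, union_subset hBA (hEs.trans sdiff_subset), by linarith⟩,
      subset_union_left, fun E' h1 h2 h3 => ?_⟩
    have := le_csSup hVb ⟨E', h1, h2, h3, rfl⟩
    simp only [hun]
    linarith
  choose f hf using step
  let S : ℕ → T := fun n => f^[n] ⟨∅, .empty, empty_subset _, by simpa using hr0⟩
  have hS : ∀ n, S (n + 1) = f (S n) := fun n => Function.iterate_succ_apply' f n _
  have hmono : Monotone fun n => (S n).1 := monotone_nat_of_le_succ fun n => by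
    rw [hS]
    exact (hf _).1
  have hlim : Filter.Tendsto (fun n => P.real (S n).1) Filter.atTop
      (nhds (P.real (⋃ n, (S n).1))) :=
    (ENNReal.tendsto_toReal (measure_ne_top _ _)).comp (tendsto_measure_iUnion_atTop hmono)
  have hle : P.real (⋃ n, (S n).1) ≤ r := le_of_tendsto' hlim fun n => (S n).2.2.2
  refine ⟨⋃ n, (S n).1, iUnion_subset fun n => (S n).2.2.1,
    MeasurableSet.iUnion fun n => (S n).2.1, hle.antisymm ?_⟩
  by_contra! hlt
  have hsub : (⋃ n, (S n).1) ⊆ A := iUnion_subset fun n => (S n).2.2.1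
  have hmeas : MeasurableSet (⋃ n, (S n).1) := MeasurableSet.iUnion fun n => (S n).2.1
  have hdiff : P.real (A \ ⋃ n, (S n).1) = P.real A - P.real (⋃ n, (S n).1) :=
    measureReal_sdiff hsub hmeas
  obtain ⟨E, hEs, hE, hE0, hEr⟩ := hP.exists_subset_measureReal_le (hA.diff hmeas)
    (by linarith) (sub_pos.2 hlt)
  have hbound : ∀ n, P.real E ≤ 2 * (P.real (S (n + 1)).1 - P.real (S n).1) := by
    intro n
    rw [hS]
    refine (hf (S n)).2 E (hEs.trans (sdiff_subset_sdiff_right (subset_iUnion (fun n => (S n).1) n))) hE ?_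
    have : P.real (S n).1 ≤ P.real (⋃ n, (S n).1) :=
      measureReal_mono (subset_iUnion (fun n => (S n).1) n)
    linarith
  have hzero := ge_of_tendsto'
    (((hlim.comp (Filter.tendsto_add_atTop_nat 1)).sub hlim).const_mul 2) hbound
  simp only [sub_self, mul_zero] at hzero
  linarith

lemma AtomlessProb.exists_pair {P : Measure Ω} [IsProbabilityMeasure P]
    (hP : AtomlessProb P) {u v c : ℝ} (hc : 0 ≤ c) (hcu : c ≤ u) (hcv : c ≤ v) (hu : u ≤ 1)
    (huv : u + v - 1 ≤ c) : ∃ A B : Set Ω, MeasurableSet A ∧ MeasurableSet B ∧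
      P.real A = u ∧ P.real B = v ∧ P.real (A ∩ B) = c := by
  obtain ⟨A, -, hA, hAu⟩ := hP.exists_subset_measureReal_eq MeasurableSet.univ
    (hc.trans hcu) (by simpa using hu)
  obtain ⟨B, hBA, hB, hBc⟩ := hP.exists_subset_measureReal_eq hA hc (by rw [hAu]; exact hcu)
  obtain ⟨E, hEA, hE, hEv⟩ := hP.exists_subset_measureReal_eq hA.compl (r := v - c)
    (by linarith) (by rw [probReal_compl_eq_one_sub hA]; linarith)
  refine ⟨A, B ∪ E, hA, hB.union hE, hAu, ?_, ?_⟩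
  · rw [measureReal_union (disjoint_compl_right.mono hBA hEA) hE, hBc, hEv]
    ring
  · rw [inter_union_distrib_left, inter_eq_self_of_subset_right hBA,
      (disjoint_compl_right.mono_right hEA).inter_eq, union_empty, hBc]

lemma indicator_compl_one_le {α : Type*} (A : Set α) (x : ℝ) :
    {ω | Aᶜ.indicator (1 : α → ℝ) ω ≤ x} = if x < 0 then ∅ else if x < 1 then A else univ := by
  ext ω
  by_cases hω : ω ∈ A <;> split_ifs <;> simp [hω] <;> linarith

lemma hasCopula_indicator {P : Measure Ω} [IsProbabilityMeasure P] {C : ℝ → ℝ → ℝ}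
    (hC : IsCopula C) {A B : Set Ω} (h : P.real (A ∩ B) = C (P.real A) (P.real B)) :
    HasCopula P (Aᶜ.indicator 1) (Bᶜ.indicator 1) C := by
  intro x y
  rw [ofPred_and, indicator_compl_one_le, indicator_compl_one_le]
  have hA : (P A).toReal ∈ Icc (0:ℝ) 1 := toReal_prob_mem_Icc P A
  have hB : (P B).toReal ∈ Icc (0:ℝ) 1 := toReal_prob_mem_Icc P B
  have h0 := hC.1 0 (by simp)
  have h1 := hC.1 1 (by simp)
  simp only [measureReal_def] at h
  split_ifs <;> simp [h, h0, h1, hC.1 _ hA, hC.1 _ hB]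

lemma identDistrib_indicator {P : Measure Ω} [IsProbabilityMeasure P] {A B : Set Ω}
    (hA : MeasurableSet A) (hB : MeasurableSet B) (h : P.real A = P.real B) :
    IdentDistrib (Aᶜ.indicator (1 : Ω → ℝ)) (Bᶜ.indicator 1) P P := by
  have mA : Measurable (Aᶜ.indicator (1 : Ω → ℝ)) := measurable_one.indicator hA.compl
  have mB : Measurable (Bᶜ.indicator (1 : Ω → ℝ)) := measurable_one.indicator hB.compl
  refine ⟨mA.aemeasurable, mB.aemeasurable, ?_⟩
  have : IsProbabilityMeasure (P.map (Aᶜ.indicator (1 : Ω → ℝ))) :=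
    Measure.isProbabilityMeasure_map mA.aemeasurable
  refine Measure.ext_of_Iic _ _ fun x => ?_
  rw [Measure.map_apply mA measurableSet_Iic, Measure.map_apply mB measurableSet_Iic]
  change P {ω | Aᶜ.indicator (1 : Ω → ℝ) ω ≤ x} = P {ω | Bᶜ.indicator (1 : Ω → ℝ) ω ≤ x}
  rw [indicator_compl_one_le, indicator_compl_one_le]
  have : P A = P B := (measureReal_eq_measureReal_iff).1 h
  split_ifs <;> simp [this]

lemma isBddRV_indicator {A : Set Ω} (hA : MeasurableSet A) :
    IsBddRV (Aᶜ.indicator (1 : Ω → ℝ)) := by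
  refine ⟨measurable_one.indicator hA.compl, 1, fun ω => ?_⟩
  by_cases hω : ω ∈ A <;> simp [hω]

lemma distExp_indicator_add {P : Measure Ω} [IsProbabilityMeasure P] {h : ℝ → ℝ}
    (hdist : IsDistortion h) {A B : Set Ω} (hA : MeasurableSet A) (hB : MeasurableSet B) :
    distExp P h (fun ω => Aᶜ.indicator (1 : Ω → ℝ) ω + Bᶜ.indicator (1 : Ω → ℝ) ω) =
      h (1 - P.real (A ∩ B)) + h (1 - P.real A - P.real B + P.real (A ∩ B)) := by
  have e1 : P.real (A ∩ B)ᶜ = 1 - P.real (A ∩ B) := probReal_compl_eq_one_sub (hA.inter hB)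
  have e2 : P.real (Aᶜ ∩ Bᶜ) = 1 - P.real A - P.real B + P.real (A ∩ B) := by
    rw [← compl_union, probReal_compl_eq_one_sub (hA.union hB)]
    linarith [measureReal_union_add_inter (μ := P) (s := A) hB]
  rw [← e1, ← e2]
  have neg : ∫ x in Iio (0:ℝ), (h (P {ω | Aᶜ.indicator (1 : Ω → ℝ) ω +
      Bᶜ.indicator (1 : Ω → ℝ) ω > x}).toReal - 1) = 0 := by
    refine setIntegral_eq_zero_of_forall_eq_zero fun x hx => ?_
    have hx : x < 0 := hx
    have : {ω | Aᶜ.indicator (1 : Ω → ℝ) ω + Bᶜ.indicator (1 : Ω → ℝ) ω > x} = univ := by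
      refine eq_univ_of_forall fun ω => hx.trans_le ?_
      by_cases h1 : ω ∈ A <;> by_cases h2 : ω ∈ B <;> simp [h1, h2]
    rw [this]
    simp [hdist.2.2]
  have pos : EqOn (fun x => h (P {ω | Aᶜ.indicator (1 : Ω → ℝ) ω +
      Bᶜ.indicator (1 : Ω → ℝ) ω > x}).toReal)
      (fun x => (Iio (1:ℝ)).indicator (fun _ => h (P.real (A ∩ B)ᶜ)) x +
        (Ico (1:ℝ) 2).indicator (fun _ => h (P.real (Aᶜ ∩ Bᶜ))) x) (Ioi 0) := by
    intro x hx
    have hx : 0 < x := hx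
    dsimp only
    rcases lt_or_ge x 1 with h1 | h1
    · have : {ω | Aᶜ.indicator (1 : Ω → ℝ) ω + Bᶜ.indicator (1 : Ω → ℝ) ω > x} =
          (A ∩ B)ᶜ := by
        ext ω
        by_cases h1 : ω ∈ A <;> by_cases h2 : ω ∈ B <;> simp [h1, h2] <;> linarith
      rw [this, indicator_of_mem (show x ∈ Iio 1 from h1),
        indicator_of_notMem (fun hx' => absurd hx'.1 (not_le.2 h1)), add_zero, measureReal_def]
    rw [indicator_of_notMem (show x ∉ Iio 1 from not_lt.2 h1), zero_add]
    rcases lt_or_ge x 2 with h2 | h2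
    · have : {ω | Aᶜ.indicator (1 : Ω → ℝ) ω + Bᶜ.indicator (1 : Ω → ℝ) ω > x} =
          Aᶜ ∩ Bᶜ := by
        ext ω
        by_cases h1 : ω ∈ A <;> by_cases h2 : ω ∈ B <;> simp [h1, h2] <;> linarith
      rw [this, indicator_of_mem (show x ∈ Ico 1 2 from ⟨h1, h2⟩), measureReal_def]
    · have : {ω | Aᶜ.indicator (1 : Ω → ℝ) ω + Bᶜ.indicator (1 : Ω → ℝ) ω > x} = ∅ := by
        ext ω
        by_cases h1 : ω ∈ A <;> by_cases h2 : ω ∈ B <;> simp [h1, h2] <;> linarith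
      rw [this, indicator_of_notMem (fun hx' => absurd hx'.2 (not_lt.2 h2))]
      simp [hdist.2.1]
  rw [distExp, neg, add_zero, setIntegral_congr_fun measurableSet_Ioi pos, integral_add,
    setIntegral_indicator measurableSet_Iio, setIntegral_indicator measurableSet_Ico,
    Ioi_inter_Iio, inter_eq_self_of_subset_right
      (show Ico (1:ℝ) 2 ⊆ Ioi 0 from fun x hx => one_pos.trans_le hx.1)]
  · norm_num
  · rw [integrable_indicator_iff measurableSet_Iio,
      IntegrableOn, Measure.restrict_restrict measurableSet_Iio, Iio_inter_Ioi]
    exact integrableOn_const (by simp)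
  · exact (integrable_indicator_iff measurableSet_Ico).2
      ((integrableOn_const (by simp)).mono_measure Measure.restrict_le_self)

/-- A copula that is optimal within a class beats any other member on two-valued margins. -/
lemma UnivOptimalWithin.le_of_mem {P : Measure Ω} [IsProbabilityMeasure P]
    (hP : AtomlessProb P) {h : ℝ → ℝ} (hdist : IsDistortion h) {C C' : ℝ → ℝ → ℝ}
    {𝒞 : Set (ℝ → ℝ → ℝ)} (hopt : UnivOptimalWithin P h C 𝒞) (hC : IsCopula C)
    (hC' : IsCopula C') (hmem : C' ∈ 𝒞) {u v : ℝ} (hu : u ∈ Icc (0:ℝ) 1)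
    (hv : v ∈ Icc (0:ℝ) 1) :
    h (1 - C u v) + h (1 - u - v + C u v) ≤ h (1 - C' u v) + h (1 - u - v + C' u v) := by
  obtain ⟨A, B, hA, hB, hAu, hBv, hAB⟩ := hP.exists_pair (hC.nonneg hu hv) (hC.le_left hu hv)
    (hC.le_right hu hv) hu.2 (hC.add_sub_one_le hu hv)
  obtain ⟨A', B', hA', hB', hAu', hBv', hAB'⟩ := hP.exists_pair (hC'.nonneg hu hv)
    (hC'.le_left hu hv) (hC'.le_right hu hv) hu.2 (hC'.add_sub_one_le hu hv)
  have := hopt _ _ _ _ (isBddRV_indicator hA) (isBddRV_indicator hB) (isBddRV_indicator hA')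
    (isBddRV_indicator hB') (hasCopula_indicator hC (by rw [hAu, hBv, hAB]))
    ⟨C', hmem, hasCopula_indicator hC' (by rw [hAu', hBv', hAB'])⟩
    (identDistrib_indicator hA hA' (by rw [hAu, hAu']))
    (identDistrib_indicator hB hB' (by rw [hBv, hBv']))
  rwa [distExp_indicator_add hdist hA hB, distExp_indicator_add hdist hA' hB', hAu, hBv, hAB,
    hAu', hBv', hAB'] at this

theorem eq_Cpm_of_univOptimalWithin {P : Measure Ω} [IsProbabilityMeasure P]
    (hP : AtomlessProb P) {h : ℝ → ℝ} (hdist : IsDistortion h) {p : ℝ}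
    (hp : p ∈ Ioo (0:ℝ) 1) (hiss : IsStrictISS h p) {C : ℝ → ℝ → ℝ} (hC : C ∈ copulaSet p)
    (hopt : UnivOptimalWithin P h C (copulaSet p)) {u v : ℝ} (hu : u ∈ Icc (0:ℝ) 1)
    (hv : v ∈ Icc (0:ℝ) 1) : C u v = Cpm p u v := by
  obtain ⟨hcont, hcc, hcv⟩ := hiss
  have hmem := Cpm_mem_copulaSet hp
  have key := hopt.le_of_mem hP hdist hC.1 hmem.1 hmem hu hv
  by_cases hlow : u ≤ 1 - p ∨ v ≤ 1 - p
  · refine (le_Cpm_of_mem_copulaSet hC hu hv hlow).antisymm ?_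
    by_cases hupp : 1 - p ≤ u ∨ 1 - p ≤ v
    · exact Cpm_le_of_mem_copulaSet hp hC hu hv hupp
    by_contra! hlt
    push Not at hupp
    have h1 := hC.1.le_left hu hv
    have h2 := hC.1.nonneg hu hv
    have h3 := hmem.1.le_left hu hv
    have h4 := hmem.1.le_right hu hv
    have hqm : 1 - p ∈ Icc (0:ℝ) 1 := ⟨by linarith [hp.2], by linarith [hp.1]⟩
    have h5 := hC.1.2 _ _ _ _ hu hqm hv hqm hupp.1.le hupp.2.le
    have h6 := Cpm_le_of_mem_copulaSet hp hC hu hqm (Or.inr le_rfl)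
    have h7 := Cpm_le_of_mem_copulaSet hp hC hqm hv (Or.inl le_rfl)
    rw [Cpm, if_pos (min_le_right _ _), min_eq_left hupp.1.le] at h6
    rw [Cpm, if_pos (min_le_left _ _), min_eq_right hupp.2.le] at h7
    rw [hC.2] at h5
    have := hcv.neg.add_lt_add_of_spread_Icc hp.2
      (hcont.mono (Icc_subset_Icc_left hp.1.le)).neg
      (A := 1 - u - v + C u v) (B := 1 - Cpm p u v) (D := 1 - C u v)
      (by linarith) (by linarith) (by linarith) (by linarith)
    simp only [Pi.neg_apply] at this
    rw [show 1 - u - v + C u v + (1 - C u v) - (1 - Cpm p u v) = 1 - u - v + Cpm p u v by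
      ring] at this
    linarith
  · push Not at hlow
    refine le_antisymm ?_ (Cpm_le_of_mem_copulaSet hp hC hu hv (Or.inl hlow.1.le))
    by_contra! hlt
    have h0 := hmem.1.add_sub_one_le hu hv
    have h1 := hC.1.le_left hu hv
    have h2 := hC.1.le_right hu hv
    have h3 : Cpm p u v = max (u + v - 1) (1 - p) :=
      if_neg (not_le.2 (lt_min hlow.1 hlow.2))
    have h4 : 1 - p ≤ Cpm p u v := h3 ▸ le_max_right _ _
    have := hcc.add_lt_add_of_spread_Icc hp.1 (hcont.mono (Icc_subset_Icc_right hp.2.le))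
      (A := 1 - u - v + Cpm p u v) (B := 1 - C u v) (D := 1 - Cpm p u v)
      (by linarith) (by linarith) (by linarith) (by linarith)
    rw [show 1 - u - v + Cpm p u v + (1 - Cpm p u v) - (1 - C u v) = 1 - u - v + C u v by
      ring] at this
    linarith

/-- For an ISS distortion h with inflection point p, the copula C^±_p is
universally optimal within 𝒞_p for h; if h is strictly ISS, it is the unique such
copula in 𝒞_p. -/
theorem Cpm_univOptimal_within_copulaSet_of_ISS
    (P : Measure Ω) [IsProbabilityMeasure P] (hP : AtomlessProb P)
    (h : ℝ → ℝ) (hdist : IsDistortion h)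
    (p : ℝ) (hp : p ∈ Ioo (0:ℝ) 1) (hiss : IsISS h p) :
    UnivOptimalWithin P h (Cpm p) (copulaSet p) ∧
    (IsStrictISS h p →
      ∀ C ∈ copulaSet p, UnivOptimalWithin P h C (copulaSet p) →
        ∀ u ∈ Icc (0:ℝ) 1, ∀ v ∈ Icc (0:ℝ) 1, C u v = Cpm p u v) :=
  ⟨Cpm_univOptimalWithin P hdist hp hiss, fun hstrict _ hC hopt _ hu _ hv =>
    eq_Cpm_of_univOptimalWithin hP hdist hp hstrict hC hopt hu hv⟩
end
end

section
/- Sufficiency in the ISS characterization: Let h be an inverse S-shaped distortion function with inflection point p∈(0,1), and suppose the right derivatives satisfy h'(p⁺) ≥ h'(0⁺). Then the copula C^±_p is universally optimal for h with linear cost: for all bounded random variables X, Y with copula C^±_p and all bounded X', Y' with X' equal in distribution to X and Y' equal in distribution to Y, E^h[X+Y] ≤ E^h[X'+Y']. -/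
open MeasureTheory Set ProbabilityTheory

noncomputable section

variable {Ω : Type*} [MeasurableSpace Ω]

theorem convexOn_Icc_of_Ioo {f : ℝ → ℝ} {α β : ℝ} (hαβ : α < β)
    (hf : ContinuousOn f (Icc α β)) (hconv : ConvexOn ℝ (Ioo α β) f) :
    ConvexOn ℝ (Icc α β) f := by
  refine ⟨convex_Icc α β, ?_⟩
  intro x hx y hy a b ha hb hab
  set m := (α + β) / 2 with hm
  have hmem : ∀ z ∈ Icc α β, ∀ t ∈ Ioo (0:ℝ) 1, z + t * (m - z) ∈ Ioo α β := by
    rintro z ⟨hz1, hz2⟩ t ⟨ht0, ht1⟩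
    constructor <;> nlinarith
  have hlim : ∀ z ∈ Icc α β, Filter.Tendsto (fun t : ℝ => f (z + t * (m - z)))
      (nhdsWithin 0 (Ioo 0 1)) (nhds (f z)) := by
    intro z hz
    refine (hf z hz).tendsto.comp (tendsto_nhdsWithin_iff.2 ⟨?_, ?_⟩)
    · have : Continuous (fun t : ℝ => z + t * (m - z)) := by fun_prop
      simpa using (this.tendsto 0).mono_left nhdsWithin_le_nhds
    · filter_upwards [self_mem_nhdsWithin] with t ht
      exact Ioo_subset_Icc_self (hmem z hz t ht)
  have : (nhdsWithin (0:ℝ) (Ioo 0 1)).NeBot := by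
    rw [← mem_closure_iff_nhdsWithin_neBot, closure_Ioo (by norm_num)]; simp
  have hz : a • x + b • y ∈ Icc α β := convex_Icc α β hx hy ha hb hab
  refine le_of_tendsto_of_tendsto (hlim _ hz)
    (((hlim x hx).const_smul a).add ((hlim y hy).const_smul b)) ?_
  filter_upwards [self_mem_nhdsWithin] with t ht
  have := hconv.2 (hmem x hx t ht) (hmem y hy t ht) ha hb hab
  convert this using 2
  simp only [smul_eq_mul]
  linear_combination -(t * m) * hab

theorem ConvexOn.monotoneOn_of_right_deriv_nonneg {f : ℝ → ℝ} {α β d : ℝ}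
    (hconv : ConvexOn ℝ (Icc α β) f) (hd : HasDerivWithinAt f d (Ioi α) α) (hd0 : 0 ≤ d) :
    MonotoneOn f (Icc α β) := by
  have key : ∀ y ∈ Icc α β, f α ≤ f y := by
    intro y hy
    rcases hy.1.eq_or_lt with rfl | hlt
    · exact le_rfl
    · have := hconv.le_slope_of_hasDerivWithinAt_Ioi ⟨le_rfl, hlt.le.trans hy.2⟩ hy hlt hd
      rw [slope_def_field] at this
      have h2 : 0 ≤ (f y - f α) / (y - α) := hd0.trans this
      have := mul_nonneg h2 (sub_nonneg.2 hlt.le)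
      rw [div_mul_cancel₀ _ (sub_pos.2 hlt).ne'] at this
      linarith
  intro x hx y hy hxy
  rcases hx.1.eq_or_lt with rfl | hlt
  · exact key y hy
  rcases hxy.eq_or_lt with rfl | hlt'
  · exact le_rfl
  have h1 := hconv.slope_mono_adjacent ⟨le_rfl, hlt.le.trans hx.2⟩ hy hlt hlt'
  have h2 : 0 ≤ (f x - f α) / (x - α) :=
    div_nonneg (sub_nonneg.2 (key x hx)) (sub_pos.2 hlt).le
  have := mul_nonneg (h2.trans h1) (sub_nonneg.2 hlt'.le)
  rw [div_mul_cancel₀ _ (sub_pos.2 hlt').ne'] at this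
  linarith

theorem setIntegral_nonneg_of_isLowerSet {f : ℝ → ℝ} (hf : Integrable f)
    (hint : ∀ c, 0 ≤ ∫ x in Iio c, f x) {S : Set ℝ} (hS : IsLowerSet S) :
    0 ≤ ∫ x in S, f x := by
  by_cases hne : S.Nonempty
  · by_cases hb : BddAbove S
    · have h1 : S ⊆ Iic (sSup S) := fun x hx => le_csSup hb hx
      have h2 : Iio (sSup S) ⊆ S := by
        intro x hx
        obtain ⟨y, hy, hxy⟩ := exists_lt_of_lt_csSup hne hx
        exact hS hxy.le hy
      have h3 : S =ᵐ[volume] Iio (sSup S) :=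
        Filter.EventuallyLE.antisymm
          ((LE.le.eventuallyLE h1).trans Iio_ae_eq_Iic.symm.le)
          (LE.le.eventuallyLE h2)
      rw [setIntegral_congr_set h3]
      exact hint _
    · have : S = univ := by
        refine eq_univ_of_forall fun x => ?_
        obtain ⟨y, hy, hxy⟩ := not_bddAbove_iff.1 hb x
        exact hS hxy.le hy
      rw [this, setIntegral_univ]
      exact ge_of_tendsto' ((aecover_Iio (μ := volume)
        Filter.tendsto_id).integral_tendsto_of_countably_generated hf) hint
  · rw [not_nonempty_iff_eq_empty.1 hne]; simp

theorem integral_mul_nonneg_of_antitone {k f : ℝ → ℝ} {K : ℝ} (hk : Antitone k)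
    (hk0 : ∀ x, 0 ≤ k x) (hkK : ∀ x, k x ≤ K) (hf : Integrable f)
    (hint : ∀ c, 0 ≤ ∫ x in Iio c, f x) : 0 ≤ ∫ x, k x * f x := by
  have h1 : ∀ x, k x * f x =
      ∫ s in Ioc 0 K, {q : ℝ × ℝ | q.2 < k q.1}.indicator (fun q => f q.1) (x, s) := by
    intro x
    have : ∀ s, {q : ℝ × ℝ | q.2 < k q.1}.indicator (fun q => f q.1) (x, s) =
        (Iio (k x)).indicator (fun _ => f x) s := fun s => rfl
    simp only [this]
    rw [setIntegral_indicator measurableSet_Iio]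
    have h2 : Ioc 0 K ∩ Iio (k x) = Ioo 0 (k x) := by
      ext s; simp only [mem_inter_iff, mem_Ioc, mem_Iio, mem_Ioo]
      exact ⟨fun h => ⟨h.1.1, h.2⟩, fun h => ⟨⟨h.1, h.2.le.trans (hkK x)⟩, h.2⟩⟩
    rw [h2, setIntegral_const]
    simp [hk0 x, Measure.real]
  simp only [h1]
  rw [integral_integral_swap]
  · refine integral_nonneg fun s => ?_
    have : ∀ x, {q : ℝ × ℝ | q.2 < k q.1}.indicator (fun q => f q.1) (x, s) =
        {x | s < k x}.indicator f x := fun s => rfl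
    simp only [this]
    rw [Pi.zero_apply, integral_indicator (measurableSet_lt measurable_const hk.measurable)]
    exact setIntegral_nonneg_of_isLowerSet hf hint
      (fun x y hyx hx => lt_of_lt_of_le hx (hk hyx))
  · exact (hf.comp_fst _).indicator
      (measurableSet_lt measurable_snd (hk.measurable.comp measurable_fst))

theorem integrable_of_bounded_of_support_subset_Icc {g : ℝ → ℝ} {A B C : ℝ} (hg : Measurable g)
    (h0 : ∀ x, x ∉ Icc A B → g x = 0) (hC : ∀ x, |g x| ≤ C) : Integrable g := by
  have : IntegrableOn g (Icc A B) :=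
    Measure.integrableOn_of_bounded (by simp) hg.aestronglyMeasurable
      (Filter.Eventually.of_forall hC)
  exact (integrableOn_iff_integrable_of_support_subset
    (fun x hx => by by_contra hh; exact hx (h0 x hh))).1 this

theorem integral_comp_le_of_antitone_of_partial_integrals {φ u v : ℝ → ℝ} {α β M : ℝ} (hαβ : α ≤ β)
    (hconv : ConvexOn ℝ (Icc α β) φ) (hmono : MonotoneOn φ (Icc α β))
    (hcont : ContinuousOn φ (Icc α β)) (hu : Antitone u) (hv : Measurable v)
    (hu' : ∀ x, u x ∈ Icc α β) (hv' : ∀ x, v x ∈ Icc α β)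
    (hM : ∀ x, x ∉ Icc (-M) M → u x = v x)
    (hint : ∀ c, 0 ≤ ∫ x in Iio c, (v x - u x)) :
    0 ≤ ∫ x, (φ (v x) - φ (u x)) := by
  set Φ : ℝ → ℝ := fun t => φ (max α (min t β)) with hΦ
  have hproj : ∀ t, max α (min t β) ∈ Icc α β := fun t =>
    ⟨le_max_left _ _, max_le hαβ (min_le_right _ _)⟩
  have hΦcont : Continuous Φ :=
    hcont.comp_continuous (by fun_prop) hproj
  have hΦmono : Monotone Φ := fun s t hst =>
    hmono (hproj s) (hproj t) (max_le_max le_rfl (min_le_min hst le_rfl))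
  have hΦeq : ∀ t ∈ Icc α β, Φ t = φ t := by
    intro t ht; simp only [hΦ]; rw [min_eq_left ht.2, max_eq_right ht.1]
  have hΦconv : ConvexOn ℝ (Iic β) Φ := by
    refine ⟨convex_Iic β, ?_⟩
    intro x hx y hy a b ha hb hab
    have hz : a • x + b • y ∈ Iic β := convex_Iic β hx hy ha hb hab
    have e : ∀ z ∈ Iic β, Φ z = φ (max α z) := by
      intro z hz; simp only [hΦ]; rw [min_eq_left hz]
    have me : ∀ z ∈ Iic β, max α z ∈ Icc α β := fun z hz => ⟨le_max_left _ _, max_le hαβ hz⟩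
    rw [e _ hz, e _ hx, e _ hy]
    refine le_trans (hmono (me _ hz) (convex_Icc α β (me _ hx) (me _ hy) ha hb hab) ?_)
      (hconv.2 (me _ hx) (me _ hy) ha hb hab)
    simp only [smul_eq_mul]
    refine max_le ?_ ?_
    · calc α = a * α + b * α := by rw [← add_mul, hab, one_mul]
        _ ≤ _ := add_le_add (mul_le_mul_of_nonneg_left (le_max_left α x) ha)
          (mul_le_mul_of_nonneg_left (le_max_left α y) hb)
    · exact add_le_add (mul_le_mul_of_nonneg_left (le_max_right α x) ha)
        (mul_le_mul_of_nonneg_left (le_max_right α y) hb)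
  have hfi : ∀ g : ℝ → ℝ, Measurable g → (∀ x, x ∉ Icc (-M) M → g x = 0) →
      (∃ C, ∀ x, |g x| ≤ C) → Integrable g := fun g hg h0 ⟨_, hC⟩ =>
    integrable_of_bounded_of_support_subset_Icc hg h0 hC
  have habs : ∀ x, |v x - u x| ≤ β - α := by
    intro x; rw [abs_le]
    constructor <;> linarith [(hu' x).1, (hu' x).2, (hv' x).1, (hv' x).2]
  have hIvu : Integrable (fun x => v x - u x) :=
    hfi _ (hv.sub hu.measurable) (fun x hx => by rw [hM x hx, sub_self]) ⟨_, habs⟩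
  have hsub : ∀ x, φ (v x) - φ (u x) = Φ (v x) - Φ (u x) := fun x => by
    rw [hΦeq _ (hv' x), hΦeq _ (hu' x)]
  simp only [hsub]
  have hIΦ : Integrable (fun x => Φ (v x) - Φ (u x)) := by
    refine hfi _ ((hΦcont.measurable.comp hv).sub (hΦcont.measurable.comp hu.measurable))
      (fun x hx => by rw [hM x hx, sub_self]) ⟨Φ β - Φ α, fun x => ?_⟩
    rw [abs_le]
    have := hΦmono (hu' x).1
    have := hΦmono (hu' x).2
    have := hΦmono (hv' x).1
    have := hΦmono (hv' x).2
    constructor <;> linarith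
  have main : ∀ ω > 0, -(ω * volume.real (Icc (-M) M)) ≤ ∫ x, (Φ (v x) - Φ (u x)) := by
    intro ω hω
    have huc := (isCompact_Icc (a := α - 1) (b := β)).uniformContinuousOn_of_continuous
      hΦcont.continuousOn
    rw [Metric.uniformContinuousOn_iff] at huc
    obtain ⟨δ, hδ, hδ'⟩ := huc ω hω
    obtain ⟨ε, hε, hεδ, hε1⟩ : ∃ ε > 0, ε < δ ∧ ε ≤ 1 :=
      ⟨min (δ / 2) 1, by positivity, (min_le_left _ _).trans_lt (by linarith), min_le_right _ _⟩
    have hω' : ∀ t ∈ Icc α β, Φ t - Φ (t - ε) ≤ ω := by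
      intro t ht
      have := hδ' t ⟨by linarith [ht.1], ht.2⟩ (t - ε)
        ⟨by linarith [ht.1], by linarith [ht.2]⟩ (by
          rw [Real.dist_eq]; simpa [abs_of_pos hε] using hεδ)
      rw [Real.dist_eq] at this
      exact (le_abs_self _).trans this.le
    set ψ : ℝ → ℝ := fun t => (Φ t - Φ (t - ε)) / ε with hψ
    have hψ0 : ∀ t, 0 ≤ ψ t := fun t =>
      div_nonneg (sub_nonneg.2 (hΦmono (by linarith))) hε.le
    have hψmono : ∀ s t, s ≤ t → t ≤ β → ψ s ≤ ψ t := by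
      intro s t hst ht
      rcases hst.eq_or_lt with rfl | hlt
      · exact le_rfl
      have h1 := hΦconv.secant_mono (a := s - ε) (x := s) (y := t) (by simp; linarith)
        (by simp; linarith) ht (by linarith) (by linarith) hst
      have h2 := hΦconv.secant_mono (a := t) (x := s - ε) (y := t - ε) ht (by simp; linarith)
        (by simp; linarith) (by linarith) (by linarith) (by linarith)
      have e1 : (Φ (s - ε) - Φ t) / (s - ε - t) = (Φ t - Φ (s - ε)) / (t - (s - ε)) := by
        rw [← neg_div_neg_eq]; ring_nf
      have e2 : (Φ (t - ε) - Φ t) / (t - ε - t) = ψ t := by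
        rw [← neg_div_neg_eq]; simp only [hψ]; ring_nf
      have e3 : (Φ s - Φ (s - ε)) / (s - (s - ε)) = ψ s := by
        simp only [hψ]; ring_nf
      rw [e1, e2] at h2
      rw [e3] at h1
      exact h1.trans h2
    have hψsub : ∀ t ∈ Icc α β, ∀ s ∈ Icc α β, Φ t + ψ t * (s - t) - ω ≤ Φ s := by
      intro t ht s hs
      have hψe : ψ t * ε = Φ t - Φ (t - ε) := by simp only [hψ]; field_simp
      rcases lt_trichotomy s t with hlt | rfl | hlt
      · rcases lt_or_ge (t - ε) s with h1 | h1
        · have := hω' t ht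
          have := hΦmono h1.le
          nlinarith [hψ0 t]
        · have h2 := hΦconv.secant_mono (a := t) (x := s) (y := t - ε) ht.2 hs.2
            (by simp; linarith [ht.2]) (by linarith) (by linarith) h1
          have e2 : (Φ (t - ε) - Φ t) / (t - ε - t) = ψ t := by
            rw [← neg_div_neg_eq]; simp only [hψ]; ring_nf
          rw [e2, div_le_iff_of_neg (by linarith)] at h2
          linarith
      · linarith
      · have h2 := hΦconv.secant_mono (a := t) (x := t - ε) (y := s) ht.2
          (by simp; linarith [ht.2]) hs.2 (by linarith) (by linarith) (by linarith)
        have e2 : (Φ (t - ε) - Φ t) / (t - ε - t) = ψ t := by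
          rw [← neg_div_neg_eq]; simp only [hψ]; ring_nf
        rw [e2, le_div_iff₀ (by linarith)] at h2
        linarith
    have hk : Antitone (fun x => ψ (u x)) := fun x y hxy => hψmono _ _ (hu hxy) (hu' x).2
    have h0 := integral_mul_nonneg_of_antitone (K := ψ β) hk (fun x => hψ0 _)
      (fun x => hψmono _ _ (hu' x).2 le_rfl) hIvu hint
    have hIk : Integrable (fun x => ψ (u x) * (v x - u x)) := by
      refine hfi _ (hk.measurable.mul (hv.sub hu.measurable))
        (fun x hx => by rw [hM x hx, sub_self, mul_zero]) ⟨ψ β * (β - α), fun x => ?_⟩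
      rw [abs_mul, abs_of_nonneg (hψ0 _)]
      exact mul_le_mul (hψmono _ _ (hu' x).2 le_rfl) (habs x) (abs_nonneg _) (hψ0 _)
    have hIω : Integrable ((Icc (-M) M).indicator (fun _ => ω)) :=
      (integrable_indicator_iff measurableSet_Icc).2 (integrableOn_const (by simp))
    have hle : ∫ x, (ψ (u x) * (v x - u x) - (Icc (-M) M).indicator (fun _ => ω) x) ≤
        ∫ x, (Φ (v x) - Φ (u x)) := by
      refine integral_mono (hIk.sub hIω) hIΦ fun x => ?_
      by_cases hx : x ∈ Icc (-M) M
      · have := hψsub _ (hu' x) _ (hv' x)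
        simp only [indicator_of_mem hx]
        linarith
      · simp [indicator_of_notMem hx, hM x hx]
    rw [integral_sub hIk hIω, integral_indicator_const _ measurableSet_Icc, smul_eq_mul] at hle
    linarith
  by_contra hneg
  push Not at hneg
  set V := volume.real (Icc (-M) M) with hV
  have hV0 : 0 ≤ V := measureReal_nonneg
  have := main (-(∫ x, (Φ (v x) - Φ (u x))) / (V + 1)) (div_pos (by linarith) (by linarith))
  rw [div_mul_eq_mul_div, ← neg_div, div_le_iff₀ (by linarith)] at this
  nlinarith

theorem lintegral_Iio_measure_le (Q : Measure Ω) [SFinite Q] {Z : Ω → ℝ} (hZ : Measurable Z)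
    (c : ℝ) : ∫⁻ x in Iio c, Q {ω | Z ω ≤ x} = ∫⁻ ω, ENNReal.ofReal (c - Z ω) ∂Q := by
  have hE : MeasurableSet {q : Ω × ℝ | Z q.1 ≤ q.2} :=
    measurableSet_le (hZ.comp measurable_fst) measurable_snd
  have h1 := Measure.prod_apply (μ := Q) (ν := volume.restrict (Iio c)) hE
  rw [Measure.prod_apply_symm hE] at h1
  refine Eq.trans h1 (lintegral_congr fun ω => ?_)
  have : Prod.mk ω ⁻¹' {q : Ω × ℝ | Z q.1 ≤ q.2} = Ici (Z ω) := rfl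
  rw [this, Measure.restrict_apply measurableSet_Ici, Ici_inter_Iio, Real.volume_Ico]

theorem measurable_measure_le (Q : Measure Ω) (Z : Ω → ℝ) :
    Measurable (fun x : ℝ => Q {ω | Z ω ≤ x}) :=
  (Monotone.measurable fun _ _ hxy => measure_mono fun _ hω => le_trans hω hxy)

theorem measurable_measure_le_and_le (Q : Measure Ω) [SFinite Q] {X Y : Ω → ℝ}
    (hX : Measurable X) (hY : Measurable Y) (c : ℝ) :
    Measurable (fun t : ℝ => Q {ω | X ω ≤ t ∧ Y ω ≤ c - t}) := by
  have hE : MeasurableSet {q : Ω × ℝ | X q.1 ≤ q.2 ∧ Y q.1 ≤ c - q.2} :=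
    (measurableSet_le (hX.comp measurable_fst) measurable_snd).inter
      (measurableSet_le (hY.comp measurable_fst) (measurable_const.sub measurable_snd))
  exact measurable_measure_prodMk_right hE

theorem lintegral_measure_le_and_le (Q : Measure Ω) [SFinite Q] {X Y : Ω → ℝ}
    (hX : Measurable X) (hY : Measurable Y) (c : ℝ) :
    ∫⁻ t, Q {ω | X ω ≤ t ∧ Y ω ≤ c - t} = ∫⁻ ω, ENNReal.ofReal (c - (X ω + Y ω)) ∂Q := by
  have hE : MeasurableSet {q : Ω × ℝ | X q.1 ≤ q.2 ∧ Y q.1 ≤ c - q.2} :=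
    (measurableSet_le (hX.comp measurable_fst) measurable_snd).inter
      (measurableSet_le (hY.comp measurable_fst) (measurable_const.sub measurable_snd))
  have h1 := Measure.prod_apply (μ := Q) (ν := volume) hE
  rw [Measure.prod_apply_symm hE] at h1
  refine Eq.trans h1 (lintegral_congr fun ω => ?_)
  have : Prod.mk ω ⁻¹' {q : Ω × ℝ | X q.1 ≤ q.2 ∧ Y q.1 ≤ c - q.2} = Icc (X ω) (c - Y ω) := by
    ext t
    simp only [mem_preimage, mem_ofPred_eq, mem_Icc]
    exact and_congr_right fun _ => le_sub_comm
  rw [this, Real.volume_Icc]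
  congr 1; ring

theorem integral_Iio_measureReal_add_le (Q : Measure Ω) [IsFiniteMeasure Q] {X Y : Ω → ℝ}
    (hX : Measurable X) (hY : Measurable Y) (c : ℝ) :
    ∫ x in Iio c, Q.real {ω | X ω + Y ω ≤ x} = ∫ t, Q.real {ω | X ω ≤ t ∧ Y ω ≤ c - t} := by
  simp only [Measure.real]
  rw [integral_toReal (measurable_measure_le Q fun ω => X ω + Y ω).aemeasurable (by simp),
    integral_toReal (measurable_measure_le_and_le Q hX hY c).aemeasurable (by simp),
    lintegral_measure_le_and_le Q hX hY]
  exact congrArg ENNReal.toReal (lintegral_Iio_measure_le Q (hX.add hY) c)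

theorem integral_Iio_measureReal_le (Q : Measure Ω) [IsFiniteMeasure Q] {Z : Ω → ℝ}
    (hZ : Measurable Z) {c : ℝ} (hc : ∀ ω, Z ω ≤ c) :
    ∫ x in Iio c, Q.real {ω | Z ω ≤ x} = ∫ ω, (c - Z ω) ∂Q := by
  simp only [Measure.real]
  rw [integral_toReal (measurable_measure_le Q Z).aemeasurable (by simp),
    lintegral_Iio_measure_le Q hZ, integral_eq_lintegral_of_nonneg_ae
      (Filter.Eventually.of_forall fun ω => sub_nonneg.2 (hc ω))
      (measurable_const.sub hZ).aestronglyMeasurable]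

theorem exists_quantile_s11 (P : Measure Ω) [IsProbabilityMeasure P] {Z : Ω → ℝ} (hZ : Measurable Z)
    {q : ℝ} (hq0 : 0 < q) (hq1 : q < 1) :
    ∃ e, (∀ x < e, P.real {ω | Z ω ≤ x} < q) ∧ ∀ x ≥ e, q ≤ P.real {ω | Z ω ≤ x} := by
  have : IsProbabilityMeasure (P.map Z) := Measure.isProbabilityMeasure_map hZ.aemeasurable
  have hcdf : ∀ x, P.real {ω | Z ω ≤ x} = cdf (P.map Z) x := fun x => by
    rw [cdf_eq_real, map_measureReal_apply hZ measurableSet_Iic]; rfl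
  simp only [hcdf]
  set F := cdf (P.map Z)
  set S := {x | q ≤ F x} with hS
  have hne : S.Nonempty :=
    ((tendsto_cdf_atTop (P.map Z)).eventually (Ici_mem_nhds hq1)).exists
  obtain ⟨l, hl⟩ := ((tendsto_cdf_atBot (P.map Z)).eventually (gt_mem_nhds hq0)).exists
  have hbdd : BddBelow S := ⟨l, fun x hx => by
    by_contra hh
    push Not at hh
    have h1 : F x ≤ F l := F.mono hh.le
    exact absurd (hx.trans h1) (not_le.2 hl)⟩
  refine ⟨sInf S, fun x hx => ?_, fun x hx => ?_⟩
  · by_contra hh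
    exact absurd (csInf_le hbdd (not_lt.1 hh)) (not_le.2 hx)
  · refine le_trans ?_ (F.mono hx)
    have h1 : ∀ y > sInf S, q ≤ F y := by
      intro y hy
      obtain ⟨z, hz, hzy⟩ := exists_lt_of_csInf_lt hne hy
      exact le_trans hz (F.mono hzy.le)
    have h2 : Filter.Tendsto F (nhdsWithin (sInf S) (Ioi (sInf S))) (nhds (F (sInf S))) :=
      ((F.right_continuous (sInf S)).mono Ioi_subset_Ici_self).tendsto
    exact ge_of_tendsto h2 (by filter_upwards [self_mem_nhdsWithin] with y hy using h1 y hy)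

/-- The restriction of `P` to an upper tail event of `Z` of mass `p`, splitting an atom if
necessary. -/
theorem exists_upperTail_measure (P : Measure Ω) [IsProbabilityMeasure P] {Z : Ω → ℝ}
    (hZ : Measurable Z) {p : ℝ} (hp : p ∈ Ioo (0:ℝ) 1) :
    ∃ Q : Measure Ω, IsFiniteMeasure Q ∧ Q ≤ P ∧ Q.real univ = p ∧
      ∀ x, Q.real {ω | Z ω ≤ x} = max (P.real {ω | Z ω ≤ x} - (1 - p)) 0 := by
  obtain ⟨e, he1, he2⟩ := exists_quantile_s11 P hZ (q := 1 - p) (by linarith [hp.2]) (by linarith [hp.1])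
  have mle : ∀ x, MeasurableSet {ω | Z ω ≤ x} := fun x => measurableSet_le hZ measurable_const
  have mgt : MeasurableSet {ω | e < Z ω} := measurableSet_lt measurable_const hZ
  have meq : MeasurableSet {ω | Z ω = e} := hZ (measurableSet_singleton e)
  have hlt : P.real {ω | Z ω < e} ≤ 1 - p := by
    obtain ⟨s, hs1, hs2, hs3⟩ := exists_seq_strictMono_tendsto e
    have hU : {ω | Z ω < e} = ⋃ n, {ω | Z ω ≤ s n} := by
      ext ω
      simp only [mem_ofPred_eq, mem_iUnion]
      refine ⟨fun hω => ?_, fun ⟨n, hn⟩ => hn.trans_lt (hs2 n)⟩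
      obtain ⟨n, hn⟩ := (hs3.eventually (lt_mem_nhds hω)).exists
      exact ⟨n, hn.le⟩
    have ht := tendsto_measure_iUnion_atTop (μ := P) (s := fun n => {ω | Z ω ≤ s n})
      (fun i j hij ω hω => le_trans hω (hs1.monotone hij))
    rw [← hU] at ht
    have ht' := (ENNReal.tendsto_toReal (measure_ne_top P _)).comp ht
    exact le_of_tendsto' ht' fun n => (he1 _ (hs2 n)).le
  have hsplit : P.real {ω | Z ω ≤ e} = P.real {ω | Z ω < e} + P.real {ω | Z ω = e} := by
    rw [← measureReal_union (by
      rw [Set.disjoint_left]; intro ω h1 h2; exact absurd h2 (ne_of_lt h1)) meq]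
    congr 1; ext ω; simp [le_iff_lt_or_eq]
  set r := P.real {ω | Z ω = e} with hr
  have hr0 : 0 ≤ r := measureReal_nonneg
  have hFe := he2 e le_rfl
  set θ : ℝ := (P.real {ω | Z ω ≤ e} - (1 - p)) / r with hθ
  have hθr : θ * r = P.real {ω | Z ω ≤ e} - (1 - p) := by
    by_cases h0 : r = 0
    · rw [h0, mul_zero]; linarith
    · rw [hθ]; field_simp
  have hθ0 : 0 ≤ θ := div_nonneg (by linarith) hr0
  have hθ1 : θ ≤ 1 := div_le_one_of_le₀ (by linarith) hr0
  set Q : Measure Ω := P.restrict {ω | e < Z ω} + ENNReal.ofReal θ • P.restrict {ω | Z ω = e} with hQ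
  have hQfin : IsFiniteMeasure Q := by
    have : IsFiniteMeasure (ENNReal.ofReal θ • P.restrict {ω | Z ω = e}) :=
      Measure.smul_finite _ ENNReal.ofReal_ne_top
    infer_instance
  have hQr : ∀ A, MeasurableSet A →
      Q.real A = P.real (A ∩ {ω | e < Z ω}) + θ * P.real (A ∩ {ω | Z ω = e}) := by
    intro A hA
    simp only [hQ, Measure.real, Measure.add_apply, Measure.smul_apply, smul_eq_mul,
      Measure.restrict_apply hA]
    rw [ENNReal.toReal_add (measure_ne_top _ _)
      (ENNReal.mul_ne_top ENNReal.ofReal_ne_top (measure_ne_top _ _)), ENNReal.toReal_mul,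
      ENNReal.toReal_ofReal hθ0]
  refine ⟨Q, hQfin, ?_, ?_, fun x => ?_⟩
  · rw [Measure.le_iff]
    intro A hA
    simp only [hQ, Measure.add_apply, Measure.smul_apply, smul_eq_mul, Measure.restrict_apply hA]
    calc _ ≤ P (A ∩ {ω | e < Z ω}) + P (A ∩ {ω | Z ω = e}) := by
          gcongr
          exact mul_le_of_le_one_left (by simp) (ENNReal.ofReal_le_one.2 hθ1)
      _ = P ((A ∩ {ω | e < Z ω}) ∪ (A ∩ {ω | Z ω = e})) := by
          rw [measure_union _ (hA.inter meq)]
          rw [Set.disjoint_left]; rintro ω ⟨_, h1⟩ ⟨_, h2⟩; exact absurd h2 (ne_of_gt h1)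
      _ ≤ P A := measure_mono (by rintro ω (h | h) <;> exact h.1)
  · rw [hQr _ MeasurableSet.univ, univ_inter, univ_inter, hθr]
    have : {ω | e < Z ω} = {ω | Z ω ≤ e}ᶜ := by ext ω; simp
    rw [this, probReal_compl_eq_one_sub (mle e)]
    ring
  · rw [hQr _ (mle x)]
    rcases lt_or_ge x e with hx | hx
    · have e1 : {ω | Z ω ≤ x} ∩ {ω | e < Z ω} = ∅ := by
        ext ω; simp only [mem_inter_iff, mem_ofPred_eq, mem_empty_iff_false, iff_false]
        rintro ⟨h1, h2⟩; linarith
      have e2 : {ω | Z ω ≤ x} ∩ {ω | Z ω = e} = ∅ := by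
        ext ω; simp only [mem_inter_iff, mem_ofPred_eq, mem_empty_iff_false, iff_false]
        rintro ⟨h1, h2⟩; linarith
      rw [e1, e2, max_eq_right (by linarith [he1 x hx])]
      simp
    · have e2 : {ω | Z ω ≤ x} ∩ {ω | Z ω = e} = {ω | Z ω = e} := by
        ext ω; simp only [mem_inter_iff, mem_ofPred_eq, and_iff_right_iff_imp]
        intro h; linarith
      have e1 : {ω | Z ω ≤ x} ∩ {ω | e < Z ω} = {ω | Z ω ≤ x} \ {ω | Z ω ≤ e} := by
        ext ω; simp
      rw [e2, hθr, e1, measureReal_sdiff (s₁ := {ω | Z ω ≤ x}) (s₂ := {ω | Z ω ≤ e})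
        (fun ω hω => le_trans hω hx) (mle e),
        max_eq_left (by linarith [he2 x hx])]
      ring

theorem Cpm_eq_add {p u v : ℝ} (hu : u ≤ 1) (hv : v ≤ 1) :
    Cpm p u v = min (min u v) (1 - p) + max (u + v - (2 - p)) 0 := by
  unfold Cpm
  split_ifs with h
  · rw [min_eq_left h, max_eq_right, add_zero]
    rcases min_le_iff.1 h with h | h <;> linarith
  · rw [min_eq_right (not_le.1 h).le, ← max_add_add_left]
    congr 1 <;> ring

theorem integral_min_min_sub {F G : ℝ → ℝ} {q a b c L : ℝ} (hF : Monotone F) (hG : Monotone G)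
    (hF0 : ∀ x, 0 ≤ F x) (hG0 : ∀ x, 0 ≤ G x) (hFL : ∀ x < L, F x = 0) (hGL : ∀ x < L, G x = 0)
    (hq : 0 ≤ q) (ha1 : ∀ x < a, F x < q) (ha2 : ∀ x ≥ a, q ≤ F x)
    (hb2 : ∀ x ≥ b, q ≤ G x) (hc : a + b ≤ c) :
    ∫ t, min (min (F t) (G (c - t))) q =
      (∫ t in Iio a, F t) + (∫ t in Iic b, min (G t) q) + q * (c - (a + b)) := by
  have hGm : Measurable (fun t => G (c - t)) :=
    hG.measurable.comp (measurable_const.sub measurable_id)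
  have hmeas : Measurable (fun t => min (min (F t) (G (c - t))) q) :=
    (hF.measurable.min hGm).min measurable_const
  have hint : Integrable (fun t => min (min (F t) (G (c - t))) q) := by
    refine integrable_of_bounded_of_support_subset_Icc (A := L) (B := c - L) (C := q) hmeas ?_ ?_
    · intro x hx
      simp only [mem_Icc, not_and_or, not_le] at hx
      rcases hx with hx | hx
      · rw [hFL x hx, min_eq_left (hG0 _), min_eq_left hq]
      · rw [hGL (c - x) (by linarith), min_eq_right (hF0 _), min_eq_left hq]
    · intro x
      rw [abs_of_nonneg (le_min (le_min (hF0 _) (hG0 _)) hq)]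
      exact min_le_right _ _
  have hB : IntegrableOn (fun t => min (G t) q) (Iic (c - a)) := by
    rw [← integrable_indicator_iff measurableSet_Iic]
    refine integrable_of_bounded_of_support_subset_Icc (A := L) (B := c - a) (C := q)
      ((hG.measurable.min measurable_const).indicator measurableSet_Iic) ?_ ?_
    · intro x hx
      by_cases h : x ∈ Iic (c - a)
      · rw [indicator_of_mem h, hGL x, min_eq_left hq]
        by_contra hh
        exact hx ⟨not_lt.1 hh, h⟩
      · exact indicator_of_notMem h _
    · intro x
      by_cases h : x ∈ Iic (c - a)
      · rw [indicator_of_mem h, abs_of_nonneg (le_min (hG0 _) hq)]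
        exact min_le_right _ _
      · rw [indicator_of_notMem h]; simpa using hq
  rw [← integral_add_compl measurableSet_Iio hint (s := Iio a), add_assoc, compl_Iio]
  congr 1
  · refine setIntegral_congr_fun measurableSet_Iio fun t ht => ?_
    have h1 := ha1 t ht
    have h2 := hb2 (c - t) (by simp only [mem_Iio] at ht; linarith)
    rw [min_eq_left (h1.le.trans h2), min_eq_left h1.le]
  · have e1 : ∫ t in Ici a, min (min (F t) (G (c - t))) q =
        ∫ t, (Iic (c - a)).indicator (fun s => min (G s) q) (c - t) := by
      rw [← integral_indicator measurableSet_Ici]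
      congr 1
      ext t
      by_cases h : a ≤ t
      · have h' : c - t ∈ Iic (c - a) := sub_le_sub_left h c
        rw [indicator_of_mem (show t ∈ Ici a from h), indicator_of_mem h']
        have := ha2 t h
        rw [min_comm (F t), min_assoc, min_eq_right this]
      · have h' : c - t ∉ Iic (c - a) := fun h' => h (by rw [mem_Iic] at h'; linarith)
        rw [indicator_of_notMem (show t ∉ Ici a from h), indicator_of_notMem h']
    rw [e1, integral_sub_left_eq_self
      (fun s => (Iic (c - a)).indicator (fun s => min (G s) q) s) volume c,
      integral_indicator measurableSet_Iic]
    have hbc : b ≤ c - a := by linarith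
    rw [← Iic_union_Ioc_eq_Iic hbc, setIntegral_union (by
      rw [Set.disjoint_left]; intro x h1 h2; exact absurd h1 (not_le.2 h2.1)) measurableSet_Ioc
      (hB.mono_set (Iic_subset_Iic.2 hbc)) (hB.mono_set (fun x hx => hx.2))]
    congr 1
    have : ∫ t in Ioc b (c - a), min (G t) q = ∫ t in Ioc b (c - a), q :=
      setIntegral_congr_fun measurableSet_Ioc fun t ht => min_eq_right (hb2 t ht.1.le)
    rw [this, setIntegral_const]
    simp [hbc, Measure.real]
    ring

theorem integrable_measureReal_le_and_le (Q : Measure Ω) [IsFiniteMeasure Q] {X Y : Ω → ℝ}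
    (hX : Measurable X) (hY : Measurable Y) {N : ℝ} (hXN : ∀ ω, -N ≤ X ω) (hYN : ∀ ω, -N ≤ Y ω)
    (c : ℝ) : Integrable (fun t => Q.real {ω | X ω ≤ t ∧ Y ω ≤ c - t}) := by
  refine integrable_of_bounded_of_support_subset_Icc (A := -N) (B := c + N) (C := Q.real univ)
    (measurable_measure_le_and_le Q hX hY c).ennreal_toReal (fun t ht => ?_) (fun t => ?_)
  · have : {ω | X ω ≤ t ∧ Y ω ≤ c - t} = ∅ := by
      ext ω
      simp only [mem_ofPred_eq, mem_empty_iff_false, iff_false]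
      rintro ⟨h1, h2⟩
      exact ht ⟨(hXN ω).trans h1, by linarith [hYN ω]⟩
    rw [this, measureReal_empty]
  · rw [abs_of_nonneg measureReal_nonneg]
    exact measureReal_mono (subset_univ _)

theorem monotone_measureReal_le (P : Measure Ω) [IsFiniteMeasure P] (Z : Ω → ℝ) :
    Monotone (fun x => P.real {ω | Z ω ≤ x}) :=
  fun _ _ hxy => measureReal_mono (fun _ hω => le_trans hω hxy)

theorem measureReal_le_eq_zero (P : Measure Ω) {Z : Ω → ℝ} {K x : ℝ}
    (hZK : ∀ ω, -K ≤ Z ω) (hx : x < -K) : P.real {ω | Z ω ≤ x} = 0 := by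
  have : {ω | Z ω ≤ x} = ∅ := by
    ext ω
    simp only [mem_ofPred_eq, mem_empty_iff_false, iff_false]
    intro h; linarith [hZK ω]
  rw [this, measureReal_empty]

theorem integrableOn_Iio_measureReal_le (P : Measure Ω) [IsFiniteMeasure P] {Z : Ω → ℝ} {K : ℝ}
    (hZK : ∀ ω, -K ≤ Z ω) (c : ℝ) : IntegrableOn (fun x => P.real {ω | Z ω ≤ x}) (Iio c) := by
  rw [← integrable_indicator_iff measurableSet_Iio]
  refine integrable_of_bounded_of_support_subset_Icc (A := -K) (B := c) (C := P.real univ)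
    ((monotone_measureReal_le P Z).measurable.indicator measurableSet_Iio)
    (fun x hx => ?_) (fun x => ?_)
  · by_cases h : x ∈ Iio c
    · rw [indicator_of_mem h]
      refine measureReal_le_eq_zero P hZK ?_
      by_contra hh
      exact hx ⟨not_lt.1 hh, le_of_lt h⟩
    · exact indicator_of_notMem h _
  · by_cases h : x ∈ Iio c
    · rw [indicator_of_mem h, abs_of_nonneg measureReal_nonneg]
      exact measureReal_mono (subset_univ _)
    · rw [indicator_of_notMem h, abs_zero]; exact measureReal_nonneg

theorem integral_Iio_cdf_le_of_le {P : Measure Ω} [IsProbabilityMeasure P] {X Y X' Y' : Ω → ℝ}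
    (hX : Measurable X) (hY : Measurable Y) (hX' : Measurable X') (hY' : Measurable Y')
    {N : ℝ} (hXN : ∀ ω, -N ≤ X ω) (hYN : ∀ ω, -N ≤ Y ω) (hXN' : ∀ ω, -N ≤ X' ω)
    (hYN' : ∀ ω, -N ≤ Y' ω) {p : ℝ} (hC : HasCopula P X Y (Cpm p))
    (hXX : ∀ t, P.real {ω | X' ω ≤ t} = P.real {ω | X ω ≤ t})
    (hYY : ∀ t, P.real {ω | Y' ω ≤ t} = P.real {ω | Y ω ≤ t}) {a b c : ℝ}
    (ha : ∀ t < a, P.real {ω | X ω ≤ t} < 1 - p) (hb : ∀ t < b, P.real {ω | Y ω ≤ t} < 1 - p)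
    (hc : c ≤ a + b) :
    ∫ x in Iio c, P.real {ω | X' ω + Y' ω ≤ x} ≤ ∫ x in Iio c, P.real {ω | X ω + Y ω ≤ x} := by
  rw [integral_Iio_measureReal_add_le P hX hY, integral_Iio_measureReal_add_le P hX' hY']
  refine integral_mono_ae (integrable_measureReal_le_and_le P hX' hY' hXN' hYN' c)
    (integrable_measureReal_le_and_le P hX hY hXN hYN c) ?_
  have hne : ∀ᵐ t : ℝ, t ≠ a := compl_mem_ae_iff.2 (measure_singleton a)
  filter_upwards [hne] with t ht
  have h1 : P.real {ω | X ω ≤ t ∧ Y ω ≤ c - t} = _ := hC t (c - t)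
  have h2 : P.real {ω | X' ω ≤ t ∧ Y' ω ≤ c - t} ≤
      min (P.real {ω | X ω ≤ t}) (P.real {ω | Y ω ≤ c - t}) := by
    rw [← hXX, ← hYY]
    exact le_min (measureReal_mono fun ω h => h.1) (measureReal_mono fun ω h => h.2)
  refine h2.trans (h1.trans (if_pos ?_)).ge
  rcases lt_or_gt_of_ne ht with h | h
  · exact (min_le_left _ _).trans (ha t h).le
  · exact (min_le_right _ _).trans (hb _ (by linarith)).le

theorem cdf_add_le_of_lt {P : Measure Ω} [IsProbabilityMeasure P] {X Y : Ω → ℝ}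
    (hY : Measurable Y) {p : ℝ} (hC : HasCopula P X Y (Cpm p)) {a b x : ℝ}
    (ha : ∀ t < a, P.real {ω | X ω ≤ t} < 1 - p) (hb : ∀ t < b, P.real {ω | Y ω ≤ t} < 1 - p)
    (hx : x < a + b) : P.real {ω | X ω + Y ω ≤ x} ≤ 1 - p := by
  obtain ⟨t, s, ht, hs, hts⟩ : ∃ t s, t < a ∧ s < b ∧ x ≤ t + s :=
    ⟨a - (a + b - x) / 2, b - (a + b - x) / 2, by linarith, by linarith, by linarith⟩
  have h1 := ha t ht
  have h2 := hb s hs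
  have h3 : P.real {ω | X ω ≤ t ∧ Y ω ≤ s} =
      min (P.real {ω | X ω ≤ t}) (P.real {ω | Y ω ≤ s}) :=
    (hC t s).trans (if_pos ((min_le_left _ _).trans h1.le))
  have h4 := measureReal_union_add_inter (μ := P) (s := {ω | X ω ≤ t}) (t := {ω | Y ω ≤ s})
    (measurableSet_le hY measurable_const)
  have h5 : {ω | X ω ≤ t} ∩ {ω | Y ω ≤ s} = {ω | X ω ≤ t ∧ Y ω ≤ s} := rfl
  rw [h5, h3] at h4
  have h6 : P.real {ω | X ω + Y ω ≤ x} ≤ P.real ({ω | X ω ≤ t} ∪ {ω | Y ω ≤ s}) := by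
    refine measureReal_mono fun ω hω => ?_
    by_contra hh
    simp only [mem_union, mem_ofPred_eq, not_or, not_le] at hh hω
    linarith
  rcases min_choice (P.real {ω | X ω ≤ t}) (P.real {ω | Y ω ≤ s}) with h | h <;>
    rw [h] at h4 <;> linarith

theorem le_cdf_add_of_ge {P : Measure Ω} [IsProbabilityMeasure P] {X Y : Ω → ℝ}
    {p : ℝ} (hC : HasCopula P X Y (Cpm p)) {a b x : ℝ}
    (ha : ∀ t ≥ a, 1 - p ≤ P.real {ω | X ω ≤ t}) (hb : ∀ t ≥ b, 1 - p ≤ P.real {ω | Y ω ≤ t})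
    (hx : a + b ≤ x) : 1 - p ≤ P.real {ω | X ω + Y ω ≤ x} := by
  have h1 : P.real {ω | X ω ≤ a ∧ Y ω ≤ b} = _ := hC a b
  have h2 : P.real {ω | X ω ≤ a ∧ Y ω ≤ b} ≤ P.real {ω | X ω + Y ω ≤ x} :=
    measureReal_mono fun ω hω => (add_le_add hω.1 hω.2).trans hx
  have h3 := Cpm_eq_add (p := p) (measureReal_le_one (μ := P) (s := {ω | X ω ≤ a}))
    (measureReal_le_one (μ := P) (s := {ω | Y ω ≤ b}))
  rw [min_eq_right (le_min (ha a le_rfl) (hb b le_rfl))] at h3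
  have h4 := h1.trans h3
  have := le_max_right (P.real {ω | X ω ≤ a} + P.real {ω | Y ω ≤ b} - (2 - p)) 0
  linarith

theorem integral_Iio_cdf_upperTail_le {P : Measure Ω} [IsProbabilityMeasure P]
    {X Y X' Y' : Ω → ℝ}
    (hX : Measurable X) (hY : Measurable Y) (hX' : Measurable X') (hY' : Measurable Y')
    {N : ℝ} (hXN : ∀ ω, -N ≤ X ω) (hYN : ∀ ω, -N ≤ Y ω) (hXN' : ∀ ω, -N ≤ X' ω)
    (hYN' : ∀ ω, -N ≤ Y' ω) {p : ℝ} (hp : p ∈ Ioo (0:ℝ) 1) (hC : HasCopula P X Y (Cpm p))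
    (hXX : ∀ t, P.real {ω | X' ω ≤ t} = P.real {ω | X ω ≤ t})
    (hYY : ∀ t, P.real {ω | Y' ω ≤ t} = P.real {ω | Y ω ≤ t}) {a b c : ℝ}
    (ha1 : ∀ t < a, P.real {ω | X ω ≤ t} < 1 - p) (hb1 : ∀ t < b, P.real {ω | Y ω ≤ t} < 1 - p)
    (ha2 : ∀ t ≥ a, 1 - p ≤ P.real {ω | X ω ≤ t}) (hb2 : ∀ t ≥ b, 1 - p ≤ P.real {ω | Y ω ≤ t})
    (hc : a + b ≤ c) :
    ∫ x in Iio c, max (P.real {ω | X ω + Y ω ≤ x} - (1 - p)) 0 ≤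
      ∫ x in Iio c, max (P.real {ω | X' ω + Y' ω ≤ x} - (1 - p)) 0 := by
  set F : ℝ → ℝ := fun t => P.real {ω | X ω ≤ t} with hF
  set G : ℝ → ℝ := fun t => P.real {ω | Y ω ≤ t} with hG
  have hFm : Monotone F := monotone_measureReal_le P X
  have hGm : Monotone G := monotone_measureReal_le P Y
  have hF0 : ∀ t, 0 ≤ F t := fun t => measureReal_nonneg
  have hG0 : ∀ t, 0 ≤ G t := fun t => measureReal_nonneg
  have hF1 : ∀ t, F t ≤ 1 := fun t => measureReal_le_one
  have hG1 : ∀ t, G t ≤ 1 := fun t => measureReal_le_one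
  have hFN : ∀ t < -N, F t = 0 := fun t ht => measureReal_le_eq_zero P hXN ht
  have hGN : ∀ t < -N, G t = 0 := fun t ht => measureReal_le_eq_zero P hYN ht
  have hGc : ∀ c, Measurable (fun t => G (c - t)) := fun c =>
    hGm.measurable.comp (measurable_const.sub measurable_id)
  have hRint : ∀ c, Integrable (fun t => max (F t + G (c - t) - (2 - p)) 0) := fun c => by
    refine integrable_of_bounded_of_support_subset_Icc (A := -N) (B := c + N) (C := 1)
      (((hFm.measurable.add (hGc c)).sub measurable_const).max measurable_const)
      (fun t ht => max_eq_right ?_) (fun t => ?_)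
    · simp only [mem_Icc, not_and_or, not_le] at ht
      rcases ht with ht | ht
      · linarith [hFN t ht, hG1 (c - t), hp.2]
      · linarith [hGN (c - t) (by linarith), hF1 t, hp.2]
    · rw [abs_of_nonneg (le_max_right _ _)]
      exact max_le (by linarith [hF1 t, hG1 (c - t), hp.2]) zero_le_one
  have hNint : ∀ c, Integrable (fun t => min (min (F t) (G (c - t))) (1 - p)) := fun c => by
    refine integrable_of_bounded_of_support_subset_Icc (A := -N) (B := c + N) (C := 1)
      ((hFm.measurable.min (hGc c)).min measurable_const)
      (fun t ht => ?_) (fun t => ?_)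
    · simp only [mem_Icc, not_and_or, not_le] at ht
      rcases ht with ht | ht
      · rw [hFN t ht, min_eq_left (hG0 _), min_eq_left (by linarith [hp.2])]
      · rw [hGN (c - t) (by linarith), min_eq_right (hF0 _), min_eq_left (by linarith [hp.2])]
    · rw [abs_of_nonneg (le_min (le_min (hF0 _) (hG0 _)) (by linarith [hp.2]))]
      exact (min_le_right _ _).trans (by linarith [hp.1])
  have hJ : ∀ c, ∫ x in Iio c, P.real {ω | X ω + Y ω ≤ x} =
      (∫ t, min (min (F t) (G (c - t))) (1 - p)) + ∫ t, max (F t + G (c - t) - (2 - p)) 0 := by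
    intro c
    rw [integral_Iio_measureReal_add_le P hX hY, ← integral_add (hNint c) (hRint c)]
    refine integral_congr_ae (Filter.Eventually.of_forall fun t => ?_)
    exact (hC t (c - t)).trans (Cpm_eq_add (hF1 t) (hG1 _))
  have hN : ∀ c, a + b ≤ c → ∫ t, min (min (F t) (G (c - t))) (1 - p) =
      (∫ t in Iio a, F t) + (∫ t in Iic b, min (G t) (1 - p)) + (1 - p) * (c - (a + b)) :=
    fun c hc => integral_min_min_sub hFm hGm hF0 hG0 hFN hGN (by linarith [hp.2]) ha1 ha2 hb2 hc
  have hSN : ∀ ω, -(2 * N) ≤ X ω + Y ω := fun ω => by linarith [hXN ω, hYN ω]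
  have hleft : ∫ x in Iio c, max (P.real {ω | X ω + Y ω ≤ x} - (1 - p)) 0 ≤
      ∫ t, max (F t + G (c - t) - (2 - p)) 0 := by
    have hIc := integrableOn_Iio_measureReal_le P hSN c
    have hdisj : Disjoint (Iio (a + b)) (Ico (a + b) c) := by
      rw [Set.disjoint_left]; intro x h1 h2; exact absurd h1 (not_lt.2 h2.1)
    have hIco : IntegrableOn (fun x => P.real {ω | X ω + Y ω ≤ x}) (Ico (a + b) c) :=
      hIc.mono_set fun x hx => hx.2
    have e0 := setIntegral_union hdisj measurableSet_Ico
      (hIc.mono_set (Iio_subset_Iio hc)) hIco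
    rw [Iio_union_Ico_eq_Iio hc] at e0
    have z1 : ∀ x ∈ Iio (a + b), max (P.real {ω | X ω + Y ω ≤ x} - (1 - p)) 0 = 0 := fun x hx =>
      max_eq_right (by linarith [cdf_add_le_of_lt hY hC ha1 hb1 hx])
    have e1 : ∫ x in Iio c, max (P.real {ω | X ω + Y ω ≤ x} - (1 - p)) 0 =
        ∫ x in Ico (a + b) c, (P.real {ω | X ω + Y ω ≤ x} - (1 - p)) := by
      rw [setIntegral_eq_of_subset_of_forall_sdiff_eq_zero measurableSet_Iio
        (s := Ico (a + b) c) (fun x hx => hx.2)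
        (fun x hx => z1 x (lt_of_not_ge fun h => hx.2 ⟨h, hx.1⟩))]
      exact setIntegral_congr_fun measurableSet_Ico fun x hx =>
        max_eq_left (sub_nonneg.2 (le_cdf_add_of_ge hC ha2 hb2 hx.1))
    have e2 : ∫ x in Ico (a + b) c, (P.real {ω | X ω + Y ω ≤ x} - (1 - p)) =
        (∫ x in Ico (a + b) c, P.real {ω | X ω + Y ω ≤ x}) - (1 - p) * (c - (a + b)) := by
      rw [integral_sub hIco (integrableOn_const (by simp)), setIntegral_const]
      simp [hc, Measure.real]
      ring
    have h1 := hJ c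
    have h2 := hJ (a + b)
    rw [hN c hc] at h1
    rw [hN (a + b) le_rfl] at h2
    have h3 : 0 ≤ ∫ t, max (F t + G (a + b - t) - (2 - p)) 0 :=
      integral_nonneg fun t => le_max_right _ _
    rw [e1, e2]
    linarith
  refine hleft.trans ?_
  obtain ⟨Q, hQfin, hQP, hQ1, hQ⟩ := exists_upperTail_measure P (hX'.add hY') hp
  have hQ' : ∀ x, max (P.real {ω | X' ω + Y' ω ≤ x} - (1 - p)) 0 =
    Q.real {ω | X' ω + Y' ω ≤ x} := fun x => (hQ x).symm
  simp only [hQ']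
  rw [integral_Iio_measureReal_add_le Q hX' hY']
  refine integral_mono (hRint c) (integrable_measureReal_le_and_le Q hX' hY' hXN' hYN' c)
    fun t => max_le ?_ measureReal_nonneg
  have hcompl : ∀ (W : Ω → ℝ) (_ : Measurable W) (x : ℝ),
      Q.real {ω | W ω ≤ x}ᶜ ≤ 1 - P.real {ω | W ω ≤ x} := fun W hW x => by
    rw [← probReal_compl_eq_one_sub (measurableSet_le hW measurable_const)]
    exact ENNReal.toReal_mono (measure_ne_top _ _) (hQP _)
  have h1 := hcompl X' hX' t
  have h2 := hcompl Y' hY' (c - t)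
  rw [hXX] at h1
  rw [hYY] at h2
  have h3 : Q.real univ ≤ Q.real {ω | X' ω ≤ t ∧ Y' ω ≤ c - t} +
      (Q.real {ω | X' ω ≤ t}ᶜ + Q.real {ω | Y' ω ≤ c - t}ᶜ) := by
    refine le_trans (measureReal_mono fun ω _ => ?_) ((measureReal_union_le
      {ω | X' ω ≤ t ∧ Y' ω ≤ c - t} ({ω | X' ω ≤ t}ᶜ ∪ {ω | Y' ω ≤ c - t}ᶜ)).trans
      (add_le_add le_rfl (measureReal_union_le _ _)))
    simp only [mem_union, mem_ofPred_eq, mem_compl_iff]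
    tauto
  simp only [hF, hG]
  linarith

theorem integrable_comp_sub_comp {φ u v : ℝ → ℝ} {α β A B : ℝ} (hφ : MonotoneOn φ (Icc α β))
    (hu : Antitone u) (hv : Antitone v) (hu' : ∀ x, u x ∈ Icc α β) (hv' : ∀ x, v x ∈ Icc α β)
    (huv : ∀ x, x ∉ Icc A B → u x = v x) : Integrable (fun x => φ (v x) - φ (u x)) := by
  have hanti : ∀ w : ℝ → ℝ, Antitone w → (∀ x, w x ∈ Icc α β) → Antitone (fun x => φ (w x)) :=
    fun w hw hw' x y hxy => hφ (hw' y) (hw' x) (hw hxy)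
  refine integrable_of_bounded_of_support_subset_Icc (A := A) (B := B) (C := φ β - φ α)
    ((hanti v hv hv').measurable.sub (hanti u hu hu').measurable)
    (fun x hx => by rw [huv x hx, sub_self]) (fun x => ?_)
  have hαβ : α ≤ β := (hu' x).1.trans (hu' x).2
  have h1 := hφ ⟨le_rfl, hαβ⟩ (hu' x) (hu' x).1
  have h2 := hφ (hu' x) ⟨hαβ, le_rfl⟩ (hu' x).2
  have h3 := hφ ⟨le_rfl, hαβ⟩ (hv' x) (hv' x).1
  have h4 := hφ (hv' x) ⟨hαβ, le_rfl⟩ (hv' x).2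
  rw [abs_le]
  constructor <;> linarith

theorem integral_ISS_comp_sub_nonneg {h : ℝ → ℝ} {p d0 dp : ℝ} (hp : p ∈ Ioo (0:ℝ) 1)
    (hiss : IsISS h p) (hd0 : HasDerivWithinAt h d0 (Ioi 0) 0)
    (hdp : HasDerivWithinAt h dp (Ioi p) p) (hcond : d0 ≤ dp) {u v : ℝ → ℝ} {m M : ℝ}
    (hu : Antitone u) (hv : Antitone v) (hu' : ∀ x, u x ∈ Icc (0:ℝ) 1)
    (hv' : ∀ x, v x ∈ Icc (0:ℝ) 1) (huv : ∀ x, x ∉ Icc (-M) M → u x = v x)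
    (hmean : ∫ x, (v x - u x) = 0) (hum : ∀ x < m, p ≤ u x) (hum' : ∀ x ≥ m, u x ≤ p)
    (hint : ∀ c ≤ m, 0 ≤ ∫ x in Iio c, (v x - u x))
    (hint' : ∀ c ≥ m, 0 ≤ ∫ x in Iio c, (min (u x) p - min (v x) p)) :
    0 ≤ ∫ x, (h (v x) - h (u x)) := by
  obtain ⟨hcont, hconc, hconv⟩ := hiss
  have hsub1 : Icc 0 p ⊆ Icc (0:ℝ) 1 := Icc_subset_Icc_right hp.2.le
  have hsub2 : Icc p 1 ⊆ Icc (0:ℝ) 1 := Icc_subset_Icc_left hp.1.le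
  set H : ℝ → ℝ := fun t => h t - d0 * t with hH
  set g : ℝ → ℝ := fun t => d0 * t - h t with hg
  have hlin : ∀ (d x : ℝ) (s : Set ℝ), HasDerivWithinAt (fun t : ℝ => d * t) d s x :=
    fun d x s => by simpa using (hasDerivWithinAt_id x s).const_mul d
  have hHcont : ContinuousOn H (Icc p 1) := (hcont.mono hsub2).sub (by fun_prop)
  have hgcont : ContinuousOn g (Icc 0 p) := ContinuousOn.sub (by fun_prop) (hcont.mono hsub1)
  have hHconv : ConvexOn ℝ (Icc p 1) H := by
    refine convexOn_Icc_of_Ioo hp.2 hHcont ⟨convex_Ioo _ _, fun x hx y hy a b ha hb hab => ?_⟩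
    have := hconv.2 hx hy ha hb hab
    simp only [hH, smul_eq_mul] at this ⊢
    linarith
  have hgconv : ConvexOn ℝ (Icc 0 p) g := by
    refine convexOn_Icc_of_Ioo hp.1 hgcont ⟨convex_Ioo _ _, fun x hx y hy a b ha hb hab => ?_⟩
    have := hconc.2 hx hy ha hb hab
    simp only [hg, smul_eq_mul] at this ⊢
    linarith
  have hHmono : MonotoneOn H (Icc p 1) :=
    hHconv.monotoneOn_of_right_deriv_nonneg (hdp.sub (hlin d0 p _)) (sub_nonneg.2 hcond)
  have hgmono : MonotoneOn g (Icc 0 p) :=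
    hgconv.monotoneOn_of_right_deriv_nonneg ((hlin d0 0 _).sub hd0) (sub_self d0).ge
  have hmax : ∀ w : ℝ → ℝ, (∀ x, w x ∈ Icc (0:ℝ) 1) → ∀ x, max (w x) p ∈ Icc p 1 :=
    fun w hw x => ⟨le_max_right _ _, max_le (hw x).2 hp.2.le⟩
  have hmin : ∀ w : ℝ → ℝ, (∀ x, w x ∈ Icc (0:ℝ) 1) → ∀ x, min (w x) p ∈ Icc 0 p :=
    fun w hw x => ⟨le_min (hw x).1 hp.1.le, min_le_right _ _⟩
  have hamax : ∀ w : ℝ → ℝ, Antitone w → Antitone (fun x => max (w x) p) :=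
    fun w hw x y hxy => max_le_max (hw hxy) le_rfl
  have hamin : ∀ w : ℝ → ℝ, Antitone w → Antitone (fun x => min (w x) p) :=
    fun w hw x y hxy => min_le_min (hw hxy) le_rfl
  have huvmax : ∀ x, x ∉ Icc (-M) M → max (u x) p = max (v x) p := fun x hx => by rw [huv x hx]
  have huvmin : ∀ x, x ∉ Icc (-M) M → min (v x) p = min (u x) p := fun x hx => by rw [huv x hx]
  have hdec : ∀ t, h t = d0 * t + (H (max t p) - g (min t p)) - H p := fun t => by
    rcases le_total t p with ht | ht
    · rw [max_eq_right ht, min_eq_left ht]; simp only [hH, hg]; ring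
    · rw [max_eq_left ht, min_eq_right ht]; simp only [hH, hg]; ring
  have hsplit : ∀ x, h (v x) - h (u x) = d0 * (v x - u x) +
      ((H (max (v x) p) - H (max (u x) p)) + (g (min (u x) p) - g (min (v x) p))) := fun x => by
    rw [hdec (v x), hdec (u x)]; ring
  have hI0 : Integrable (fun x => v x - u x) :=
    integrable_comp_sub_comp monotoneOn_id hu hv hu' hv' huv
  have hImax : Integrable (fun x => max (v x) p - max (u x) p) :=
    integrable_comp_sub_comp monotoneOn_id (hamax u hu) (hamax v hv) (hmax u hu') (hmax v hv')
      huvmax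
  have hI1 := integrable_comp_sub_comp hHmono (hamax u hu) (hamax v hv) (hmax u hu')
    (hmax v hv') huvmax
  have hI2 := integrable_comp_sub_comp hgmono (hamin v hv) (hamin u hu) (hmin v hv')
    (hmin u hu') huvmin
  have hI12 : Integrable (fun x => (H (max (v x) p) - H (max (u x) p)) +
      (g (min (u x) p) - g (min (v x) p))) := hI1.add hI2
  simp only [hsplit]
  rw [integral_add (hI0.const_mul d0) hI12, integral_add hI1 hI2, integral_const_mul,
    hmean, mul_zero, zero_add]
  refine add_nonneg
    (integral_comp_le_of_antitone_of_partial_integrals hp.2.le hHconv hHmono hHcont (hamax u hu)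
      (hamax v hv).measurable (hmax u hu') (hmax v hv') huvmax fun c => ?_)
    (integral_comp_le_of_antitone_of_partial_integrals hp.1.le hgconv hgmono hgcont (hamin v hv)
      (hamin u hu).measurable (hmin v hv') (hmin u hu') huvmin fun c => ?_)
  · have hle : ∀ c ≤ m, 0 ≤ ∫ x in Iio c, (max (v x) p - max (u x) p) := fun c hc => by
      refine (hint c hc).trans (setIntegral_mono_on hI0.integrableOn hImax.integrableOn
        measurableSet_Iio fun x hx => ?_)
      rw [max_eq_left (hum x (lt_of_lt_of_le hx hc))]
      exact sub_le_sub_right (le_max_left _ _) _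
    rcases le_total c m with hc | hc
    · exact hle c hc
    · have hdisj : Disjoint (Iio m) (Ico m c) :=
        Set.disjoint_left.2 fun x h1 h2 => absurd h1 (not_lt.2 h2.1)
      rw [← Iio_union_Ico_eq_Iio hc, setIntegral_union hdisj measurableSet_Ico
        hImax.integrableOn hImax.integrableOn]
      refine add_nonneg (hle m le_rfl) (setIntegral_nonneg measurableSet_Ico fun x hx => ?_)
      rw [max_eq_right (hum' x hx.1)]
      exact sub_nonneg.2 (le_max_right _ _)
  · rcases le_total m c with hc | hc
    · exact hint' c hc
    · refine setIntegral_nonneg measurableSet_Iio fun x hx => ?_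
      rw [min_eq_right (hum x (lt_of_lt_of_le hx hc))]
      exact sub_nonneg.2 (min_le_right _ _)

theorem measureReal_gt_mem_Icc (P : Measure Ω) [IsProbabilityMeasure P] (Z : Ω → ℝ) (x : ℝ) :
    P.real {ω | Z ω > x} ∈ Icc (0:ℝ) 1 :=
  ⟨measureReal_nonneg, measureReal_le_one⟩

theorem antitone_measureReal_gt (P : Measure Ω) [IsFiniteMeasure P] (Z : Ω → ℝ) :
    Antitone (fun x => P.real {ω | Z ω > x}) :=
  fun _ _ hxy => measureReal_mono fun _ hω => lt_of_le_of_lt hxy hω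

theorem measureReal_gt_eq_one_sub (P : Measure Ω) [IsProbabilityMeasure P] {Z : Ω → ℝ}
    (hZ : Measurable Z) (x : ℝ) : P.real {ω | Z ω > x} = 1 - P.real {ω | Z ω ≤ x} := by
  rw [← probReal_compl_eq_one_sub (measurableSet_le hZ measurable_const)]
  congr 1; ext ω; simp

theorem measureReal_gt_eq_indicator (P : Measure Ω) [IsProbabilityMeasure P] {Z : Ω → ℝ} {M x : ℝ}
    (hZM : ∀ ω, |Z ω| ≤ M) (hx : x ∉ Icc (-M) M) :
    P.real {ω | Z ω > x} = (Iio (0:ℝ)).indicator 1 x := by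
  have hΩ : Nonempty Ω := P.nonempty_of_neZero
  have hM : 0 ≤ M := (abs_nonneg _).trans (hZM hΩ.some)
  simp only [mem_Icc, not_and_or, not_le] at hx
  rcases hx with hx | hx
  · have : {ω | Z ω > x} = univ := eq_univ_of_forall fun ω => by
      have := (abs_le.1 (hZM ω)).1
      show x < Z ω
      linarith
    rw [this, probReal_univ, indicator_of_mem (show x ∈ Iio 0 by rw [mem_Iio]; linarith),
      Pi.one_apply]
  · have : {ω | Z ω > x} = ∅ := eq_empty_of_forall_notMem fun ω hω => by
      have h1 := (abs_le.1 (hZM ω)).2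
      have h2 : x < Z ω := hω
      linarith
    rw [this, measureReal_empty,
      indicator_of_notMem (show x ∉ Iio 0 by rw [mem_Iio]; linarith)]

theorem distExp_sub_distExp {P : Measure Ω} [IsProbabilityMeasure P] {h : ℝ → ℝ}
    (hdist : IsDistortion h) {Z W : Ω → ℝ} {M : ℝ} (hZM : ∀ ω, |Z ω| ≤ M)
    (hWM : ∀ ω, |W ω| ≤ M) :
    distExp P h W - distExp P h Z =
      ∫ x, (h (P.real {ω | W ω > x}) - h (P.real {ω | Z ω > x})) := by
  have key : ∀ V : Ω → ℝ, (∀ ω, |V ω| ≤ M) →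
      Integrable (fun x => h (P.real {ω | V ω > x}) - (Iio (0:ℝ)).indicator 1 x) ∧
      distExp P h V = ∫ x, (h (P.real {ω | V ω > x}) - (Iio (0:ℝ)).indicator 1 x) := by
    intro V hV
    have hanti : Antitone (fun x => h (P.real {ω | V ω > x})) := fun x y hxy =>
      hdist.1 (measureReal_gt_mem_Icc P V y) (measureReal_gt_mem_Icc P V x)
        (antitone_measureReal_gt P V hxy)
    have hI : Integrable (fun x => h (P.real {ω | V ω > x}) - (Iio (0:ℝ)).indicator 1 x) := by
      refine integrable_of_bounded_of_support_subset_Icc (A := -M) (B := M) (C := 1)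
        (hanti.measurable.sub (measurable_one.indicator measurableSet_Iio))
        (fun x hx => ?_) (fun x => ?_)
      · rw [measureReal_gt_eq_indicator P hV hx]
        by_cases hx0 : x ∈ Iio (0:ℝ)
        · rw [indicator_of_mem hx0, Pi.one_apply, hdist.2.2, sub_self]
        · rw [indicator_of_notMem hx0, hdist.2.1, sub_self]
      · have hm := measureReal_gt_mem_Icc P V x
        have h0 := hdist.1 ⟨le_rfl, zero_le_one⟩ hm hm.1
        have h1 := hdist.1 hm ⟨zero_le_one, le_rfl⟩ hm.2
        rw [hdist.2.1] at h0
        rw [hdist.2.2] at h1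
        by_cases hx0 : x ∈ Iio (0:ℝ)
        · rw [indicator_of_mem hx0, Pi.one_apply, abs_le]; constructor <;> linarith
        · rw [indicator_of_notMem hx0, abs_le]; constructor <;> linarith
    refine ⟨hI, ?_⟩
    rw [← integral_add_compl measurableSet_Iio hI (s := Iio 0), compl_Iio,
      integral_Ici_eq_integral_Ioi, add_comm, distExp]
    congr 1
    · refine setIntegral_congr_fun measurableSet_Ioi fun x hx => ?_
      rw [indicator_of_notMem (notMem_Iio.2 (le_of_lt hx)), sub_zero]; rfl
    · refine setIntegral_congr_fun measurableSet_Iio fun x hx => ?_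
      rw [indicator_of_mem hx]; rfl
  rw [(key W hWM).2, (key Z hZM).2, ← integral_sub (key W hWM).1 (key Z hZM).1]
  congr 1
  ext x
  ring

theorem integrable_of_abs_le {P : Measure Ω} [IsFiniteMeasure P] {Z : Ω → ℝ} {M : ℝ}
    (hZ : Measurable Z) (hZM : ∀ ω, |Z ω| ≤ M) : Integrable Z P :=
  Integrable.of_bound hZ.aestronglyMeasurable M (Filter.Eventually.of_forall hZM)

/-- Sufficiency in the ISS characterization: if h is ISS with inflection
point p and the right derivatives satisfy h'(0⁺) ≤ h'(p⁺), then C^±_p is universally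
optimal for h with linear cost. -/
theorem Cpm_univOptimal_of_ISS_deriv_condition
    (P : Measure Ω) [IsProbabilityMeasure P] (hP : AtomlessProb P)
    (h : ℝ → ℝ) (hdist : IsDistortion h)
    (p : ℝ) (hp : p ∈ Ioo (0:ℝ) 1) (hiss : IsISS h p)
    (d0 dp : ℝ) (hd0 : HasDerivWithinAt h d0 (Ioi 0) 0)
    (hdp : HasDerivWithinAt h dp (Ioi p) p) (hcond : d0 ≤ dp) :
    UnivOptimal P h (Cpm p) := by
  rintro X Y X' Y' ⟨hX, N₁, hN₁⟩ ⟨hY, N₂, hN₂⟩ ⟨hX', N₃, hN₃⟩ ⟨hY', N₄, hN₄⟩ hC hXX' hYY'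
  obtain ⟨N, hNX, hNY, hNX', hNY'⟩ : ∃ N, (∀ ω, |X ω| ≤ N) ∧ (∀ ω, |Y ω| ≤ N) ∧
      (∀ ω, |X' ω| ≤ N) ∧ (∀ ω, |Y' ω| ≤ N) :=
    ⟨max (max N₁ N₂) (max N₃ N₄), fun ω => (hN₁ ω).trans (by simp),
      fun ω => (hN₂ ω).trans (by simp), fun ω => (hN₃ ω).trans (by simp),
      fun ω => (hN₄ ω).trans (by simp)⟩
  have hneg : ∀ Z : Ω → ℝ, (∀ ω, |Z ω| ≤ N) → ∀ ω, -N ≤ Z ω := fun Z hZ ω => (abs_le.1 (hZ ω)).1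
  have hXX : ∀ t, P.real {ω | X' ω ≤ t} = P.real {ω | X ω ≤ t} := fun t =>
    congrArg ENNReal.toReal (hXX'.measure_mem_eq (s := Iic t) measurableSet_Iic).symm
  have hYY : ∀ t, P.real {ω | Y' ω ≤ t} = P.real {ω | Y ω ≤ t} := fun t =>
    congrArg ENNReal.toReal (hYY'.measure_mem_eq (s := Iic t) measurableSet_Iic).symm
  obtain ⟨a, ha1, ha2⟩ := exists_quantile_s11 P hX (q := 1 - p) (by linarith [hp.2])
    (by linarith [hp.1])
  obtain ⟨b, hb1, hb2⟩ := exists_quantile_s11 P hY (q := 1 - p) (by linarith [hp.2])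
    (by linarith [hp.1])
  have hS : ∀ ω, |X ω + Y ω| ≤ 2 * N := fun ω =>
    (abs_add_le _ _).trans (by linarith [hNX ω, hNY ω])
  have hS' : ∀ ω, |X' ω + Y' ω| ≤ 2 * N := fun ω =>
    (abs_add_le _ _).trans (by linarith [hNX' ω, hNY' ω])
  rw [← sub_nonneg, distExp_sub_distExp hdist hS hS']
  set F : ℝ → ℝ := fun x => P.real {ω | X ω + Y ω ≤ x}
  set F' : ℝ → ℝ := fun x => P.real {ω | X' ω + Y' ω ≤ x}
  have hSm : Measurable (fun ω => X ω + Y ω) := hX.add hY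
  have hSm' : Measurable (fun ω => X' ω + Y' ω) := hX'.add hY'
  have hu : ∀ x, P.real {ω | X ω + Y ω > x} = 1 - F x := measureReal_gt_eq_one_sub P hSm
  have hv : ∀ x, P.real {ω | X' ω + Y' ω > x} = 1 - F' x := measureReal_gt_eq_one_sub P hSm'
  have hFint : ∀ c, IntegrableOn F (Iio c) :=
    integrableOn_Iio_measureReal_le P fun ω => (abs_le.1 (hS ω)).1
  have hFint' : ∀ c, IntegrableOn F' (Iio c) :=
    integrableOn_Iio_measureReal_le P fun ω => (abs_le.1 (hS' ω)).1
  have hpart : ∀ c, ∫ x in Iio c, (P.real {ω | X' ω + Y' ω > x} - P.real {ω | X ω + Y ω > x}) =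
      (∫ x in Iio c, F x) - ∫ x in Iio c, F' x := fun c => by
    rw [← integral_sub (hFint c) (hFint' c)]
    congr 1; ext x; rw [hu, hv]; ring
  refine integral_ISS_comp_sub_nonneg hp hiss hd0 hdp hcond (m := a + b) (M := 2 * N)
    (antitone_measureReal_gt P _) (antitone_measureReal_gt P _) (measureReal_gt_mem_Icc P _)
    (measureReal_gt_mem_Icc P _) (fun x hx => by
      rw [measureReal_gt_eq_indicator P hS hx, measureReal_gt_eq_indicator P hS' hx])
    ?_ (fun x hx => ?_) (fun x hx => ?_) (fun c hc => ?_) (fun c hc => ?_)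
  · rw [← setIntegral_eq_integral_of_forall_compl_eq_zero (s := Iio (2 * N + 1)) (fun x hx => by
      have hx' : x ∉ Icc (-(2 * N)) (2 * N) := fun h => hx (by rw [mem_Iio]; linarith [h.2])
      rw [measureReal_gt_eq_indicator P hS hx', measureReal_gt_eq_indicator P hS' hx', sub_self]),
      hpart]
    have hE : ∫ x in Iio (2 * N + 1), F x = ∫ ω, (2 * N + 1 - (X ω + Y ω)) ∂P :=
      integral_Iio_measureReal_le P hSm fun ω => by linarith [(abs_le.1 (hS ω)).2]
    have hE' : ∫ x in Iio (2 * N + 1), F' x = ∫ ω, (2 * N + 1 - (X' ω + Y' ω)) ∂P :=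
      integral_Iio_measureReal_le P hSm' fun ω => by linarith [(abs_le.1 (hS' ω)).2]
    have iX := integrable_of_abs_le (P := P) hX hNX
    have iY := integrable_of_abs_le (P := P) hY hNY
    have iX' := integrable_of_abs_le (P := P) hX' hNX'
    have iY' := integrable_of_abs_le (P := P) hY' hNY'
    rw [hE, hE', integral_sub (integrable_const _) (integrable_of_abs_le hSm hS),
      integral_sub (integrable_const _) (integrable_of_abs_le hSm' hS'), integral_add iX iY,
      integral_add iX' iY', hXX'.integral_eq, hYY'.integral_eq, sub_self]
  · rw [hu]; linarith [cdf_add_le_of_lt hY hC ha1 hb1 hx]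
  · rw [hu]; linarith [le_cdf_add_of_ge hC ha2 hb2 hx]
  · rw [hpart]
    exact sub_nonneg.2 (integral_Iio_cdf_le_of_le hX hY hX' hY' (hneg X hNX) (hneg Y hNY)
      (hneg X' hNX') (hneg Y' hNY') hC hXX hYY ha1 hb1 hc)
  · have hmin : ∀ t : ℝ, min (1 - t) p = p - max (t - (1 - p)) 0 := fun t => by
      rcases le_total (t - (1 - p)) 0 with ht | ht
      · rw [max_eq_right ht, min_eq_right (by linarith), sub_zero]
      · rw [max_eq_left ht, min_eq_left (by linarith)]; ring
    have htail : ∀ G : ℝ → ℝ, Monotone G → (∀ x, 0 ≤ G x) → IntegrableOn G (Iio c) →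
        IntegrableOn (fun x => max (G x - (1 - p)) 0) (Iio c) := fun G hG hG0 hGi =>
      hGi.mono' ((hG.measurable.sub measurable_const).max measurable_const).aestronglyMeasurable
        (Filter.Eventually.of_forall fun x => by
          rw [Real.norm_eq_abs, abs_of_nonneg (le_max_right _ _)]
          exact max_le (by linarith [hp.2]) (hG0 x))
    have hlast := integral_Iio_cdf_upperTail_le hX hY hX' hY' (hneg X hNX) (hneg Y hNY)
      (hneg X' hNX') (hneg Y' hNY') hp hC hXX hYY ha1 hb1 ha2 hb2 hc
    rw [← sub_nonneg, ← integral_sub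
      (htail F' (monotone_measureReal_le P _) (fun _ => measureReal_nonneg) (hFint' c))
      (htail F (monotone_measureReal_le P _) (fun _ => measureReal_nonneg) (hFint c))] at hlast
    refine hlast.trans_eq ?_
    congr 1; ext x; rw [hu, hv, hmin, hmin]; ring
end
end
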